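/- arXiv:1612.01932 — 3 statements merged into one kernel-verified Lean document; each statement's English description precedes it below -/
import Mathlib

section
/- Let w be a weight on ℝ and let δ > 1. Assume the Fujii–Wilson condition with constant δ: for every bounded interval J, ∫_J M(w·1_J) dx ≤ δ·w(J). Then for every bounded interval I of positive length and every measurable set E ⊆ I, one has (∫_E M(w·1_I) dx)/(∫_I M(w·1_I) dx) ≤ δ · (|E|/|I|)^{1/δ}. -/
open MeasureTheory Set ENNReal

noncomputable section

/-- The non-centered Hardy–Littlewood maximal operator on `ℝ`, as a supremum of
averages over bounded open intervals containing the point. -/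
def M1 (f : ℝ → ℝ) (x : ℝ) : ℝ≥0∞ :=
  ⨆ (a : ℝ) (b : ℝ) (_ : a < b) (_ : x ∈ Set.Ioo a b),
    (∫⁻ y in Set.Ioo a b, ENNReal.ofReal |f y|) / volume (Set.Ioo a b)

open Filter Topology in
/-- A Gronwall-type power decay estimate on `[l, ∞)` for a convex-like nonnegative function. -/
theorem le_mul_rpow_of_decay {φ m : ℝ → ℝ} {l p : ℝ} (hl : 0 < l) (hp : 0 < p)
    (h1 : ∀ s, l ≤ s → φ s ≤ p * s * m s)
    (h2 : ∀ r s, l ≤ r → r ≤ s → φ s + (s - r) * m s ≤ φ r) {x : ℝ} (hx : 1 ≤ x) :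
    φ (l * x) ≤ φ l * x ^ (-(1 / p)) := by
  have hstep : ∀ r q, l ≤ r → 1 ≤ q → φ (r * q) * (1 + (1 - q⁻¹) / p) ≤ φ r := by
    intro r q hr hq
    have hr0 : 0 < r := hl.trans_le hr
    have hq0 : 0 < q := by linarith
    have hrq : r ≤ r * q := le_mul_of_one_le_right hr0.le hq
    have e1 := h1 (r * q) (hr.trans hrq)
    have e2 := h2 r (r * q) hr hrq
    have hc : 0 ≤ (1 - q⁻¹) / p := div_nonneg (sub_nonneg.2 (inv_le_one_of_one_le₀ hq)) hp.le
    have e3 := mul_le_mul_of_nonneg_right e1 hc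
    have e4 : p * (r * q) * m (r * q) * ((1 - q⁻¹) / p) = (r * q - r) * m (r * q) := by
      field_simp
    linarith
  have hpow : ∀ q, 1 ≤ q → ∀ n : ℕ, φ (l * q ^ n) * (1 + (1 - q⁻¹) / p) ^ n ≤ φ l := by
    intro q hq n
    have hc : 0 ≤ (1 - q⁻¹) / p := div_nonneg (sub_nonneg.2 (inv_le_one_of_one_le₀ hq)) hp.le
    induction n with
    | zero => simp
    | succ n ih =>
      have e := hstep (l * q ^ n) q (le_mul_of_one_le_right hl.le (one_le_pow₀ hq)) hq
      calc φ (l * q ^ (n + 1)) * (1 + (1 - q⁻¹) / p) ^ (n + 1)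
          = φ (l * q ^ n * q) * (1 + (1 - q⁻¹) / p) * (1 + (1 - q⁻¹) / p) ^ n := by
            rw [pow_succ q, mul_assoc l]; ring
        _ ≤ φ (l * q ^ n) * (1 + (1 - q⁻¹) / p) ^ n := by gcongr
        _ ≤ φ l := ih
  have hx0 : 0 < x := by linarith
  have hL : 0 ≤ Real.log x := Real.log_nonneg hx
  have hlim : Tendsto (fun n : ℕ => (n : ℝ) * ((1 - (Real.exp (Real.log x / n))⁻¹) / p)) atTop
      (𝓝 (Real.log x / p)) := by
    have hd : HasDerivAt (fun s : ℝ => (1 - Real.exp (-(Real.log x * s))) / p)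
        (Real.log x / p) 0 := by
      have h := ((((hasDerivAt_id (0 : ℝ)).const_mul (Real.log x)).neg.exp).const_sub 1).div_const p
      simpa using h
    have ht := hd.tendsto_slope_zero_right
    have hinv : Tendsto (fun n : ℕ => ((n : ℝ))⁻¹) atTop (𝓝[>] 0) :=
      tendsto_inv_atTop_nhdsGT_zero.comp tendsto_natCast_atTop_atTop
    refine (ht.comp hinv).congr fun n => ?_
    simp [← Real.exp_neg, div_eq_mul_inv]
  have hexp := Real.tendsto_one_add_pow_exp_of_tendsto hlim
  have hle : φ (l * x) * Real.exp (Real.log x / p) ≤ φ l := by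
    refine le_of_tendsto (hexp.const_mul (φ (l * x))) ?_
    filter_upwards [eventually_gt_atTop 0] with n hn
    have hq : 1 ≤ Real.exp (Real.log x / n) := Real.one_le_exp (by positivity)
    have hqn : Real.exp (Real.log x / n) ^ n = x := by
      rw [← Real.exp_nat_mul, mul_div_cancel₀ _ (by positivity), Real.exp_log hx0]
    simpa [hqn] using hpow _ hq n
  rw [Real.rpow_def_of_pos hx0, mul_neg, Real.exp_neg, ← div_eq_mul_inv,
    le_div_iff₀ (Real.exp_pos _)]
  simpa [div_eq_mul_inv] using hle

theorem isOpen_setOf_lt_M1 (f : ℝ → ℝ) (t : ℝ≥0∞) : IsOpen {x | t < M1 f x} := by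
  have : {x | t < M1 f x} = ⋃ (a : ℝ) (b : ℝ) (_ : a < b)
      (_ : t < (∫⁻ y in Ioo a b, ENNReal.ofReal |f y|) / volume (Ioo a b)), Ioo a b := by
    ext x
    simp only [M1, lt_iSup_iff, mem_ofPred_eq, mem_iUnion, exists_prop]
    grind
  rw [this]
  exact isOpen_iUnion fun a => isOpen_iUnion fun b => isOpen_iUnion fun _ =>
    isOpen_iUnion fun _ => isOpen_Ioo

theorem measurable_M1 (f : ℝ → ℝ) : Measurable (M1 f) :=
  (lowerSemicontinuous_iff_isOpen_preimage.2 (isOpen_setOf_lt_M1 f)).measurable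

theorem average_le_M1 (f : ℝ → ℝ) {a b x : ℝ} (hx : x ∈ Ioo a b) :
    (∫⁻ y in Ioo a b, ENNReal.ofReal |f y|) / volume (Ioo a b) ≤ M1 f x :=
  le_iSup₂_of_le a b (le_iSup₂_of_le (hx.1.trans hx.2) hx le_rfl)

/-- A bounded nonempty connected component of an open subset of `ℝ` is an open interval. -/
theorem connectedComponentIn_eq_Ioo {U : Set ℝ} (hU : IsOpen U) (hb : Bornology.IsBounded U)
    {x : ℝ} (hx : x ∈ U) : ∃ c d, c < d ∧ connectedComponentIn U x = Ioo c d := by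
  set C := connectedComponentIn U x
  have hC : IsConnected C := isConnected_connectedComponentIn_iff.2 hx
  have hCo : IsOpen C := hU.connectedComponentIn
  have hCb : Bornology.IsBounded C := hb.subset (connectedComponentIn_subset U x)
  have hEq : C = Ioo (sInf C) (sSup C) := by
    refine subset_antisymm (fun y hy => ?_)
      (hC.Ioo_csInf_csSup_subset hCb.bddBelow hCb.bddAbove)
    obtain ⟨ε, hε, hball⟩ := Metric.isOpen_iff.1 hCo y hy
    have h1 : y - ε / 2 ∈ C := hball (by simp [abs_of_pos hε, hε])
    have h2 : y + ε / 2 ∈ C := hball (by simp [abs_of_pos hε, hε])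
    constructor
    · linarith [csInf_le hCb.bddBelow h1]
    · linarith [le_csSup hCb.bddAbove h2]
  have hxC : x ∈ C := mem_connectedComponentIn hx
  exact ⟨_, _, (hEq ▸ hxC).1.trans (hEq ▸ hxC).2, hEq⟩

theorem setLIntegral_le_of_M1_le {f : ℝ → ℝ} {t : ℝ≥0∞} (ht : t ≠ ∞) {c d z : ℝ} (hcd : c < d)
    (hz : z ∈ Icc c d) (hM : M1 f z ≤ t) :
    ∫⁻ y in Ioo c d, ENNReal.ofReal |f y| ≤ t * volume (Ioo c d) := by
  have hlim : Filter.Tendsto (fun ε : ℝ => t * volume (Ioo (c - ε) (d + ε)))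
      (nhdsWithin 0 (Ioi 0)) (nhds (t * volume (Ioo c d))) := by
    refine ENNReal.Tendsto.const_mul ?_ (Or.inr ht)
    simp only [Real.volume_Ioo]
    refine ENNReal.tendsto_ofReal (tendsto_nhdsWithin_of_tendsto_nhds ?_)
    have h : Continuous fun ε : ℝ => d + ε - (c - ε) := by fun_prop
    simpa using h.tendsto 0
  refine ge_of_tendsto hlim ?_
  filter_upwards [self_mem_nhdsWithin] with ε hε
  have hε : 0 < ε := hε
  have hpos : 0 < d + ε - (c - ε) := by linarith
  have h := (average_le_M1 f (a := c - ε) (b := d + ε) (x := z)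
    ⟨by linarith [hz.1], by linarith [hz.2]⟩).trans hM
  rw [ENNReal.div_le_iff (by simpa [Real.volume_Ioo] using hpos) (by simp)] at h
  refine (lintegral_mono_set (Ioo_subset_Ioo ?_ ?_)).trans h <;> linarith

/-- On a component `(c, d)` of a superlevel set inside `(a, b)`, the maximal function of
`w·1_(a,b)` only sees the values of `w` on `(c, d)`. -/
theorem M1_le_M1_of_component {w : ℝ → ℝ} {a b c d x y : ℝ} {t : ℝ≥0∞}
    (hC : connectedComponentIn {x ∈ Ioo a b | t < M1 ((Ioo a b).indicator w) x} x = Ioo c d)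
    (hy : y ∈ Ioo c d) :
    M1 ((Ioo a b).indicator w) y ≤ M1 ((Ioo c d).indicator w) y := by
  set f := (Ioo a b).indicator w with hf
  set U := {x ∈ Ioo a b | t < M1 f x}
  have hyU : y ∈ U := connectedComponentIn_subset U x (hC ▸ hy)
  have hCy : connectedComponentIn U y = Ioo c d := by
    rw [← connectedComponentIn_eq (hC ▸ hy), hC]
  have key : ∀ p q, y ∈ Ioo p q →
      t < (∫⁻ z in Ioo p q, ENNReal.ofReal |f z|) / volume (Ioo p q) →
      (∫⁻ z in Ioo p q, ENNReal.ofReal |f z|) / volume (Ioo p q) ≤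
        M1 ((Ioo c d).indicator w) y := by
    intro p q hpq ht
    have hind : (fun z => ENNReal.ofReal |f z|) =
        (Ioo a b).indicator fun z => ENNReal.ofReal |w z| := by
      ext z
      by_cases hz : z ∈ Ioo a b <;> simp [hf, hz]
    have hint : ∫⁻ z in Ioo p q, ENNReal.ofReal |f z| =
        ∫⁻ z in Ioo p q ∩ Ioo a b, ENNReal.ofReal |f z| := by
      rw [hind, setLIntegral_indicator measurableSet_Ioo, setLIntegral_indicator measurableSet_Ioo]
      congr 2
      ext z
      simp only [mem_inter_iff]
      tauto
    have hle : (∫⁻ z in Ioo p q, ENNReal.ofReal |f z|) / volume (Ioo p q) ≤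
        (∫⁻ z in Ioo p q ∩ Ioo a b, ENNReal.ofReal |f z|) / volume (Ioo p q ∩ Ioo a b) := by
      rw [hint]
      exact ENNReal.div_le_div_left (measure_mono inter_subset_left) _
    refine hle.trans ?_
    have hyi : y ∈ Ioo p q ∩ Ioo a b := ⟨hpq, hyU.1⟩
    have hsub : Ioo p q ∩ Ioo a b ⊆ U := fun z hz =>
      ⟨hz.2, ht.trans_le (average_le_M1 f hz.1)⟩
    rw [Ioo_inter_Ioo] at hyi hsub ⊢
    have hsubC := isPreconnected_Ioo.subset_connectedComponentIn hyi hsub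
    rw [hCy] at hsubC
    refine le_trans (le_of_eq ?_) (average_le_M1 _ hyi)
    congr 1
    refine setLIntegral_congr_fun measurableSet_Ioo fun z hz => ?_
    simp only [hf, indicator_of_mem (hsub hz).1, indicator_of_mem (hsubC hz)]
  refine iSup_le fun p => iSup_le fun q => iSup_le fun _ => iSup_le fun hpq => ?_
  by_cases ht : t < (∫⁻ z in Ioo p q, ENNReal.ofReal |f z|) / volume (Ioo p q)
  · exact key p q hpq ht
  · refine (not_lt.1 ht).trans ?_
    have := hyU.2
    simp only [M1, lt_iSup_iff] at this
    obtain ⟨p', q', _, hpq', ht'⟩ := this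
    exact ht'.le.trans (key p' q' hpq' ht')

theorem setLIntegral_component_le {w : ℝ → ℝ} {a b c d x : ℝ} {t : ℝ≥0∞} (htop : t ≠ ∞)
    (ht : ∫⁻ y in Ioo a b, ENNReal.ofReal |w y| ≤ t * volume (Ioo a b)) (hcd : c < d)
    (hC : connectedComponentIn {x ∈ Ioo a b | t < M1 ((Ioo a b).indicator w) x} x = Ioo c d) :
    ∫⁻ y in Ioo c d, ENNReal.ofReal |w y| ≤ t * volume (Ioo c d) := by
  set f := (Ioo a b).indicator w with hf
  set U := {x ∈ Ioo a b | t < M1 f x}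
  have hsubU : Ioo c d ⊆ U := hC ▸ connectedComponentIn_subset U x
  have hsub : Ioo c d ⊆ Ioo a b := fun z hz => (hsubU hz).1
  obtain ⟨hac, hdb⟩ := (Ioo_subset_Ioo_iff hcd).1 hsub
  have hwf : ∫⁻ y in Ioo c d, ENNReal.ofReal |w y| = ∫⁻ y in Ioo c d, ENNReal.ofReal |f y| :=
    setLIntegral_congr_fun measurableSet_Ioo fun z hz => by
      simp only [hf, indicator_of_mem (hsub hz)]
  obtain ⟨m, hm⟩ := nonempty_Ioo.2 hcd
  have hCm : connectedComponentIn U m = Ioo c d := by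
    rw [← connectedComponentIn_eq (hC ▸ hm), hC]
  have hmax : ∀ s, IsPreconnected s → m ∈ s → s ⊆ U → s ⊆ Ioo c d := fun s hs hms hsU =>
    hCm ▸ hs.subset_connectedComponentIn hms hsU
  rcases hac.eq_or_lt with rfl | hac
  · rcases hdb.eq_or_lt with rfl | hdb
    · exact ht
    · rw [hwf]
      refine setLIntegral_le_of_M1_le htop hcd (right_mem_Icc.2 hcd.le) (not_lt.1 fun h => ?_)
      have hdU : Ioc a d ⊆ U := fun z hz => by
        rcases hz.2.eq_or_lt with rfl | hzd
        · exact ⟨⟨hz.1, hdb⟩, h⟩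
        · exact hsubU ⟨hz.1, hzd⟩
      exact lt_irrefl _ (hmax _ isPreconnected_Ioc ⟨hm.1, hm.2.le⟩ hdU (right_mem_Ioc.2 hcd)).2
  · rw [hwf]
    refine setLIntegral_le_of_M1_le htop hcd (left_mem_Icc.2 hcd.le) (not_lt.1 fun h => ?_)
    have hcU : Ico c d ⊆ U := fun z hz => by
      rcases hz.1.eq_or_lt with rfl | hcz
      · exact ⟨⟨hac, hz.2.trans_le hdb⟩, h⟩
      · exact hsubU ⟨hcz, hz.2⟩
    exact lt_irrefl _ (hmax _ isPreconnected_Ico ⟨hm.1.le, hm.2⟩ hcU (left_mem_Ico.2 hcd)).1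

/-- Under the Fujii–Wilson condition, the integral of `M(w·1_I)` over its superlevel set at
height `t ≥ w(I)/|I|` is at most `δ t` times the measure of that set. -/
theorem setLIntegral_superlevel_le {w : ℝ → ℝ} {D : ℝ≥0∞}
    (hFW : ∀ a b : ℝ, a < b → ∫⁻ x in Ioo a b, M1 ((Ioo a b).indicator w) x ≤
      D * ∫⁻ x in Ioo a b, ENNReal.ofReal |w x|)
    {a b : ℝ} {t : ℝ≥0∞} (htop : t ≠ ∞)
    (ht : ∫⁻ y in Ioo a b, ENNReal.ofReal |w y| ≤ t * volume (Ioo a b)) :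
    ∫⁻ x in {x ∈ Ioo a b | t < M1 ((Ioo a b).indicator w) x}, M1 ((Ioo a b).indicator w) x ≤
      D * t * volume {x ∈ Ioo a b | t < M1 ((Ioo a b).indicator w) x} := by
  set f := (Ioo a b).indicator w with hf
  set U := {x ∈ Ioo a b | t < M1 f x} with hU
  have hUo : IsOpen U := isOpen_Ioo.inter (isOpen_setOf_lt_M1 f t)
  have hUb : Bornology.IsBounded U := (Metric.isBounded_Ioo a b).subset fun z hz => hz.1
  set S : Set (Set ℝ) := connectedComponentIn U '' U
  have hSo : ∀ C ∈ S, IsOpen C := by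
    rintro _ ⟨x, -, rfl⟩
    exact hUo.connectedComponentIn
  have hSd : S.PairwiseDisjoint id := by
    rintro _ ⟨x, -, rfl⟩ _ ⟨y, -, rfl⟩ hne
    refine disjoint_left.2 fun z hzx hzy => hne ?_
    rw [connectedComponentIn_eq hzx, connectedComponentIn_eq hzy]
  have hSc : S.Countable := hSd.countable_of_isOpen hSo <| by
    rintro _ ⟨x, hx, rfl⟩
    exact ⟨x, mem_connectedComponentIn hx⟩
  have hUS : U = ⋃ C ∈ S, id C := by
    ext z
    simp only [mem_iUnion, id, exists_prop, S, mem_image, exists_exists_and_eq_and]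
    exact ⟨fun hz => ⟨z, hz, mem_connectedComponentIn hz⟩,
      fun ⟨x, _, hz⟩ => connectedComponentIn_subset U x hz⟩
  have hSm : ∀ C ∈ S, MeasurableSet (id C) := fun C hC => (hSo C hC).measurableSet
  have hone : ∀ C ∈ S, ∫⁻ x in C, M1 f x ≤ D * t * volume C := by
    rintro _ ⟨x, hx, rfl⟩
    obtain ⟨c, d, hcd, hC⟩ := connectedComponentIn_eq_Ioo hUo hUb hx
    rw [hC]
    calc ∫⁻ y in Ioo c d, M1 f y
        ≤ ∫⁻ y in Ioo c d, M1 ((Ioo c d).indicator w) y :=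
          setLIntegral_mono' measurableSet_Ioo fun y hy => M1_le_M1_of_component hC hy
      _ ≤ D * ∫⁻ y in Ioo c d, ENNReal.ofReal |w y| := hFW c d hcd
      _ ≤ D * (t * volume (Ioo c d)) := by
          gcongr
          exact setLIntegral_component_le htop ht hcd hC
      _ = D * t * volume (Ioo c d) := by ring
  rw [hUS, lintegral_biUnion hSc hSm hSd, measure_biUnion hSc hSd hSm, ← ENNReal.tsum_mul_left]
  exact ENNReal.tsum_le_tsum fun C => hone C C.2

/-- If `g ≥ l > 0` satisfies `∫_{g > s} g ≤ δ s μ{g > s}` for all `s ≥ l`, then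
`∫_E g ≤ (μ E / μ univ)^(1/δ) ∫ g` for every measurable `E`. -/
theorem setLIntegral_le_rpow_mul_lintegral {α : Type*} [MeasurableSpace α] {μ : Measure α}
    [IsFiniteMeasure μ] {g : α → ℝ≥0∞} (hg : Measurable g) (hgi : ∫⁻ x, g x ∂μ ≠ ∞) {δ l : ℝ}
    (hδ : 1 < δ) (hl : 0 < l) (hlg : ∀ᵐ x ∂μ, ENNReal.ofReal l ≤ g x)
    (hlev : ∀ s, l ≤ s → ∫⁻ x in {x | ENNReal.ofReal s < g x}, g x ∂μ ≤
      ENNReal.ofReal δ * ENNReal.ofReal s * μ {x | ENNReal.ofReal s < g x}) (E : Set α) :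
    ∫⁻ x in E, g x ∂μ ≤ (μ E / μ univ) ^ (1 / δ) * ∫⁻ x, g x ∂μ := by
  rcases eq_or_ne (μ E) 0 with hE0 | hE0
  · simp [Measure.restrict_eq_zero.2 hE0]
  have hU0 : μ univ ≠ 0 := fun h => hE0 (measure_mono_null (subset_univ E) h)
  have hV : ∀ s : ℝ, MeasurableSet {x | ENNReal.ofReal s < g x} := fun s =>
    measurableSet_lt measurable_const hg
  set Φ : ℝ → ℝ≥0∞ := fun s => ∫⁻ x, (g x - ENNReal.ofReal s) ∂μ
  have hΦ : ∀ s, Φ s ≠ ∞ := fun s =>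
    ne_top_of_le_ne_top hgi (lintegral_mono fun x => tsub_le_self)
  have hA : ∀ s, Φ s + ENNReal.ofReal s * μ {x | ENNReal.ofReal s < g x} ≤
      ∫⁻ x in {x | ENNReal.ofReal s < g x}, g x ∂μ := fun s => by
    rw [← lintegral_indicator (hV s), ← lintegral_indicator_const (hV s),
      ← lintegral_add_left (by fun_prop)]
    refine lintegral_mono fun x => ?_
    by_cases hx : ENNReal.ofReal s < g x
    · simp [indicator, hx, tsub_add_cancel_of_le hx.le]
    · simp [indicator, hx, tsub_eq_zero_of_le (not_lt.1 hx)]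
  have hB : ∀ r s, 0 ≤ r → r ≤ s →
      Φ s + ENNReal.ofReal (s - r) * μ {x | ENNReal.ofReal s < g x} ≤ Φ r := fun r s hr hrs => by
    rw [← lintegral_indicator_const (hV s), ← lintegral_add_left (by fun_prop)]
    refine lintegral_mono fun x => ?_
    by_cases hx : ENNReal.ofReal s < g x
    · simp only [indicator, mem_ofPred_eq, hx, if_true]
      rw [ENNReal.ofReal_sub _ hr]
      exact (tsub_add_tsub_cancel hx.le (ENNReal.ofReal_le_ofReal hrs)).le
    · simp [indicator, hx, tsub_eq_zero_of_le (not_lt.1 hx)]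
  have hC : ∀ s, ∫⁻ x in E, g x ∂μ ≤ ENNReal.ofReal s * μ E + Φ s := fun s => by
    calc ∫⁻ x in E, g x ∂μ ≤ ∫⁻ x in E, (ENNReal.ofReal s + (g x - ENNReal.ofReal s)) ∂μ :=
          lintegral_mono fun x => le_add_tsub
      _ = ENNReal.ofReal s * μ E + ∫⁻ x in E, (g x - ENNReal.ofReal s) ∂μ := by
          rw [lintegral_add_left measurable_const, setLIntegral_const]
      _ ≤ _ := by
          gcongr
          exact setLIntegral_le_lintegral _ _
  have hD : Φ l + ENNReal.ofReal l * μ univ ≤ ∫⁻ x, g x ∂μ := by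
    rw [← lintegral_const, ← lintegral_add_left (by fun_prop)]
    refine lintegral_mono_ae ?_
    filter_upwards [hlg] with x hx
    exact (tsub_add_cancel_of_le hx).le
  have hδ0 : 0 < δ := by linarith
  have hdecay := @le_mul_rpow_of_decay (fun s => (Φ s).toReal)
    (fun s => μ.real {x | ENNReal.ofReal s < g x}) l (δ - 1) hl (by linarith)
    (fun s hs => by
      have hs0 : 0 ≤ s := hl.le.trans hs
      have h := ENNReal.toReal_mono (by finiteness) ((hA s).trans (hlev s hs))
      rw [ENNReal.toReal_add (hΦ s) (by finiteness)] at h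
      simp only [ENNReal.toReal_mul, ENNReal.toReal_ofReal hs0, ENNReal.toReal_ofReal hδ0.le] at h
      simp only [Measure.real]
      linarith)
    (fun r s hr hrs => by
      have h := ENNReal.toReal_mono (hΦ r) (hB r s (hl.le.trans hr) hrs)
      rw [ENNReal.toReal_add (hΦ s) (by finiteness)] at h
      simpa only [Measure.real, ENNReal.toReal_mul, ENNReal.toReal_ofReal (sub_nonneg.2 hrs)]
        using h)
  set L := μ.real univ
  have hL : 0 < L := ENNReal.toReal_pos hU0 (by finiteness)
  set r := μ.real E / L
  have hr : 0 < r := div_pos (ENNReal.toReal_pos hE0 (by finiteness)) hL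
  have hr1 : r ≤ 1 := (div_le_one hL).2 (measureReal_mono (subset_univ E))
  have hx : 1 ≤ r ^ (1 / δ - 1) := Real.one_le_rpow_of_pos_of_le_one_of_nonpos hr hr1
    (by rw [sub_nonpos, div_le_one hδ0]; exact hδ.le)
  have hx0 : 0 ≤ l * r ^ (1 / δ - 1) := by positivity
  have h1 := hdecay hx
  have hpow : (r ^ (1 / δ - 1)) ^ (-(1 / (δ - 1))) = r ^ (1 / δ) := by
    rw [← Real.rpow_mul hr.le]
    congr 1
    have : δ - 1 ≠ 0 := by linarith
    field_simp
    ring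
  have hpow' : r ^ (1 / δ - 1) * r = r ^ (1 / δ) := by
    rw [Real.rpow_sub_one hr.ne', div_mul_cancel₀ _ hr.ne']
  have h2 := ENNReal.toReal_mono (ENNReal.add_ne_top.2 ⟨by finiteness, hΦ _⟩) (hC (l * r ^ (1 / δ - 1)))
  rw [ENNReal.toReal_add (by finiteness) (hΦ _), ENNReal.toReal_mul,
    ENNReal.toReal_ofReal hx0] at h2
  have h3 := ENNReal.toReal_mono hgi hD
  rw [ENNReal.toReal_add (hΦ _) (by finiteness), ENNReal.toReal_mul,
    ENNReal.toReal_ofReal hl.le] at h3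
  have hEr : (μ E).toReal = r * L := (div_mul_cancel₀ _ hL.ne').symm
  have hfin : ∫⁻ x in E, g x ∂μ ≠ ∞ :=
    ne_top_of_le_ne_top hgi (setLIntegral_le_lintegral _ _)
  have hratio : (μ E / μ univ) ^ (1 / δ) ≠ ∞ :=
    ENNReal.rpow_ne_top_of_nonneg (by positivity) (ENNReal.div_ne_top (by finiteness) hU0)
  rw [← ENNReal.toReal_le_toReal hfin (ENNReal.mul_ne_top hratio hgi), ENNReal.toReal_mul,
    ← ENNReal.toReal_rpow, ENNReal.toReal_div]
  change _ ≤ r ^ (1 / δ) * _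
  rw [hpow] at h1
  calc (∫⁻ x in E, g x ∂μ).toReal
      ≤ l * r ^ (1 / δ - 1) * (r * L) + (Φ l).toReal * r ^ (1 / δ) := by
        rw [hEr] at h2
        linarith
    _ = r ^ (1 / δ) * ((Φ l).toReal + l * L) := by
        rw [← hpow']
        ring
    _ ≤ r ^ (1 / δ) * (∫⁻ x, g x ∂μ).toReal := by
        gcongr
        exact h3

/-- Sharp `A∞`-type measure estimate for `A∞` weights on `ℝ` with Fujii–Wilson
constant at most `δ`:
`M(w·1_I)(E) / M(w·1_I)(I) ≤ δ (|E|/|I|)^{1/δ}` for all measurable `E ⊆ I`. -/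
theorem stmt15 (w : ℝ → ℝ) (hw : ∀ x, 0 ≤ w x) (hloc : LocallyIntegrable w volume)
    (δ : ℝ) (hδ : 1 < δ)
    (hFW : ∀ a b : ℝ, a < b →
      (∫⁻ x in Set.Ioo a b, M1 ((Set.Ioo a b).indicator w) x) ≤
        ENNReal.ofReal δ * ∫⁻ x in Set.Ioo a b, ENNReal.ofReal (w x))
    (a b : ℝ) (hab : a < b) (E : Set ℝ) (hE : MeasurableSet E)
    (hEI : E ⊆ Set.Ioo a b) :
    (∫⁻ x in E, M1 ((Set.Ioo a b).indicator w) x) /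
        (∫⁻ x in Set.Ioo a b, M1 ((Set.Ioo a b).indicator w) x) ≤
      ENNReal.ofReal δ * (volume E / volume (Set.Ioo a b)) ^ (1 / δ) := by
  have hFW' : ∀ a b : ℝ, a < b → ∫⁻ x in Ioo a b, M1 ((Ioo a b).indicator w) x ≤
      ENNReal.ofReal δ * ∫⁻ x in Ioo a b, ENNReal.ofReal |w x| := by
    simpa only [abs_of_nonneg (hw _)] using hFW
  set f := (Ioo a b).indicator w with hf
  set W := ∫⁻ x in Ioo a b, ENNReal.ofReal |w x| with hW
  have hWtop : W ≠ ∞ := by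
    have h : IntegrableOn w (Ioo a b) :=
      (hloc.integrableOn_isCompact isCompact_Icc).mono_set Ioo_subset_Icc_self
    have h' := h.2
    simp only [HasFiniteIntegral, Real.enorm_eq_ofReal_abs] at h'
    exact h'.ne
  have hT : ∫⁻ x in Ioo a b, M1 f x ≤ ENNReal.ofReal δ * W := hFW' a b hab
  have hTtop : ∫⁻ x in Ioo a b, M1 f x ≠ ∞ := ne_top_of_le_ne_top (by finiteness) hT
  rcases eq_or_ne W 0 with hW0 | hW0
  · have hE0 : ∫⁻ x in E, M1 f x = 0 := by
      refine le_antisymm ((lintegral_mono_set hEI).trans (hT.trans ?_)) zero_le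
      simp [hW0]
    simp [hE0]
  have hv0 : volume (Ioo a b) ≠ 0 := by simpa using hab
  have hvtop : volume (Ioo a b) ≠ ∞ := by simp
  have hltop : W / volume (Ioo a b) ≠ ∞ := ENNReal.div_ne_top hWtop hv0
  have hof : ENNReal.ofReal (W / volume (Ioo a b)).toReal = W / volume (Ioo a b) :=
    ENNReal.ofReal_toReal hltop
  have hWf : ∫⁻ x in Ioo a b, ENNReal.ofReal |f x| = W :=
    setLIntegral_congr_fun measurableSet_Ioo fun x hx => by simp only [hf, indicator_of_mem hx]
  have : IsFiniteMeasure (volume.restrict (Ioo a b)) := ⟨by simp⟩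
  have hmain := setLIntegral_le_rpow_mul_lintegral (μ := volume.restrict (Ioo a b))
    (measurable_M1 f) hTtop hδ (ENNReal.toReal_pos (ENNReal.div_pos hW0 hvtop).ne' hltop)
    (by
      filter_upwards [ae_restrict_mem measurableSet_Ioo] with x hx
      rw [hof, ← hWf]
      exact average_le_M1 f hx)
    (fun s hs => by
      have h := setLIntegral_superlevel_le hFW' (t := ENNReal.ofReal s) (a := a) (b := b)
        ENNReal.ofReal_ne_top (by
          rw [← ENNReal.div_le_iff hv0 hvtop, ← hW, ← hof]
          exact ENNReal.ofReal_le_ofReal hs)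
      have hV := (isOpen_setOf_lt_M1 f (ENNReal.ofReal s)).measurableSet
      rw [Measure.restrict_restrict hV, Measure.restrict_apply hV, inter_comm]
      exact h) E
  rw [Measure.restrict_restrict hE, Measure.restrict_apply hE, Measure.restrict_apply_univ,
    inter_eq_self_of_subset_left hEI] at hmain
  refine (ENNReal.div_le_of_le_mul hmain).trans (le_mul_of_one_le_left' ?_)
  simpa using hδ.le
end
end

section
/- Let w be a weight on ℝⁿ and let δ > 1. Assume the Fujii–Wilson condition with constant δ: for every bounded axis-parallel cube Q′, ∫_{Q′} M(w·1_{Q′}) dx ≤ δ·w(Q′). Fix a bounded axis-parallel cube Q, let M_Q denote the local dyadic maximal operator relative to Q, and set λ₀ = (∫_Q M(w·1_Q) dx)/(δ|Q|) and c_n(δ) = δ + (2ⁿ−1)(δ−1). Then for every λ ≥ λ₀, writing E_λ = {x ∈ Q : M_Q(w·1_Q)(x) > λ}, one has ∫_{E_λ} M_Q(w·1_Q) dx ≤ c_n(δ) · λ · |E_λ|. -/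
open MeasureTheory Set ENNReal

noncomputable section

/-- A bounded axis-parallel open cube in `ℝⁿ`. -/
def IsCube {n : ℕ} (Q : Set (Fin n → ℝ)) : Prop :=
  ∃ (a : Fin n → ℝ) (s : ℝ), 0 < s ∧ Q = Set.univ.pi fun i => Set.Ioo (a i) (a i + s)

/-- The non-centered Hardy–Littlewood maximal operator over axis-parallel cubes in `ℝⁿ`. -/
def maximal {n : ℕ} (f : (Fin n → ℝ) → ℝ) (x : Fin n → ℝ) : ℝ≥0∞ :=
  ⨆ (Q : Set (Fin n → ℝ)) (_ : IsCube Q) (_ : x ∈ Q),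
    (∫⁻ y in Q, ENNReal.ofReal |f y|) / volume Q

/-- The open cube with corner `a` and side length `s`. -/
def cube {n : ℕ} (a : Fin n → ℝ) (s : ℝ) : Set (Fin n → ℝ) :=
  Set.univ.pi fun i => Set.Ioo (a i) (a i + s)

/-- The generation-`k` dyadic subcube of the cube with corner `a` and side `s`
indexed by `j : Fin n → ℕ` (with `j i < 2^k`), taken half-open so that each
generation tiles the cube. -/
def dyadicCube {n : ℕ} (a : Fin n → ℝ) (s : ℝ) (k : ℕ) (j : Fin n → ℕ) :
    Set (Fin n → ℝ) :=
  Set.univ.pi fun i =>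
    Set.Ico (a i + s * (j i : ℝ) / 2 ^ k) (a i + s * ((j i : ℝ) + 1) / 2 ^ k)

/-- The local dyadic maximal operator `M_Q` relative to the cube with corner `a`
and side `s`: the supremum of averages over the dyadic subcubes containing the
point. -/
def Mdyadic {n : ℕ} (a : Fin n → ℝ) (s : ℝ) (f : (Fin n → ℝ) → ℝ)
    (x : Fin n → ℝ) : ℝ≥0∞ :=
  ⨆ (k : ℕ) (j : Fin n → ℕ) (_ : ∀ i, j i < 2 ^ k) (_ : x ∈ dyadicCube a s k j),
    (∫⁻ y in dyadicCube a s k j, ENNReal.ofReal |f y|) / volume (dyadicCube a s k j)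

/-- The half-open cube with corner `b` and side length `t`. -/
def icoBox {n : ℕ} (b : Fin n → ℝ) (t : ℝ) : Set (Fin n → ℝ) :=
  Set.univ.pi fun i => Set.Ico (b i) (b i + t)

theorem measurableSet_icoBox {n : ℕ} (b : Fin n → ℝ) (t : ℝ) : MeasurableSet (icoBox b t) :=
  MeasurableSet.univ_pi fun _ => measurableSet_Ico

theorem cube_ae_eq_icoBox {n : ℕ} (b : Fin n → ℝ) (t : ℝ) :
    cube b t =ᵐ[volume] icoBox b t :=
  Measure.univ_pi_Ioo_ae_eq_Icc.trans Measure.univ_pi_Ico_ae_eq_Icc.symm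

theorem volume_icoBox {n : ℕ} (b : Fin n → ℝ) (t : ℝ) :
    volume (icoBox b t) = ENNReal.ofReal t ^ n := by
  simp [icoBox, Real.volume_pi_Ico]

theorem volume_cube {n : ℕ} (b : Fin n → ℝ) (t : ℝ) :
    volume (cube b t) = ENNReal.ofReal t ^ n := by
  rw [measure_congr (cube_ae_eq_icoBox b t), volume_icoBox]

theorem icoBox_subset_icoBox {n : ℕ} {b p : Fin n → ℝ} {h t : ℝ}
    (h₁ : ∀ i, p i ≤ b i) (h₂ : ∀ i, b i + h ≤ p i + t) : icoBox b h ⊆ icoBox p t :=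
  Set.pi_mono fun i _ => Set.Ico_subset_Ico (h₁ i) (h₂ i)

theorem dyadicCube_eq_icoBox {n : ℕ} (a : Fin n → ℝ) (s : ℝ) (k : ℕ) (j : Fin n → ℕ) :
    dyadicCube a s k j = icoBox (fun i => a i + s * (j i : ℝ) / 2 ^ k) (s / 2 ^ k) := by
  unfold dyadicCube icoBox
  congr! 3
  ring

theorem dyadicCube_zero {n : ℕ} (a : Fin n → ℝ) (s : ℝ) :
    dyadicCube a s 0 (fun _ => 0) = icoBox a s := by
  simp [dyadicCube, icoBox]

theorem index_unique {n : ℕ} {a : Fin n → ℝ} {s : ℝ} (hs : 0 < s) {k : ℕ} {j j' : Fin n → ℕ}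
    {x : Fin n → ℝ} (hx : x ∈ dyadicCube a s k j) (hx' : x ∈ dyadicCube a s k j') :
    j = j' := by
  have key : ∀ u v : ℕ, ∀ i, a i + s * (u : ℝ) / 2 ^ k ≤ x i →
      x i < a i + s * ((v : ℝ) + 1) / 2 ^ k → u ≤ v := by
    intro u v i h1 h2
    have h3 : s * (u : ℝ) / 2 ^ k < s * ((v : ℝ) + 1) / 2 ^ k := by linarith
    rw [div_lt_div_iff_of_pos_right (by positivity), mul_lt_mul_iff_right₀ hs] at h3
    exact Nat.lt_succ_iff.1 (by exact_mod_cast h3)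
  funext i
  have h := hx i (Set.mem_univ i)
  have h' := hx' i (Set.mem_univ i)
  exact le_antisymm (key _ _ i h.1 h'.2) (key _ _ i h'.1 h.2)

theorem dyadicCube_subset_ancestor {n : ℕ} (a : Fin n → ℝ) {s : ℝ} (hs : 0 < s) (k m : ℕ)
    (j : Fin n → ℕ) :
    dyadicCube a s (k + m) j ⊆ dyadicCube a s k (fun i => j i / 2 ^ m) := by
  refine Set.pi_mono fun i _ => Set.Ico_subset_Ico ?_ ?_
  · have h : ((j i / 2 ^ m : ℕ) : ℝ) * 2 ^ m ≤ j i := by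
      exact_mod_cast Nat.div_mul_le_self (j i) (2 ^ m)
    rw [add_le_add_iff_left, pow_add, div_le_div_iff₀ (by positivity) (by positivity)]
    nlinarith [mul_le_mul_of_nonneg_left h (by positivity : 0 ≤ s * 2 ^ k)]
  · have h : (j i : ℝ) + 1 ≤ (((j i / 2 ^ m : ℕ) : ℝ) + 1) * 2 ^ m := by
      have := Nat.lt_div_mul_add (a := j i) (b := 2 ^ m) (by positivity)
      have h2 : j i + 1 ≤ (j i / 2 ^ m + 1) * 2 ^ m := by rw [add_mul, one_mul]; exact this
      exact_mod_cast h2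
    rw [add_le_add_iff_left, pow_add, div_le_div_iff₀ (by positivity) (by positivity)]
    nlinarith [mul_le_mul_of_nonneg_left h (by positivity : 0 ≤ s * 2 ^ k)]

theorem dyadicCube_subset_icoBox {n : ℕ} (a : Fin n → ℝ) {s : ℝ} (hs : 0 < s) (k : ℕ)
    (j : Fin n → ℕ) (hj : ∀ i, j i < 2 ^ k) : dyadicCube a s k j ⊆ icoBox a s := by
  have h := dyadicCube_subset_ancestor a hs 0 k j
  rw [zero_add] at h
  rw [← dyadicCube_zero]
  convert h using 2
  funext i
  exact (Nat.div_eq_of_lt (hj i)).symm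

/-- Averages over half-open cubes are controlled by the maximal function over open cubes. -/
theorem average_icoBox_le_maximal {n : ℕ} (g : (Fin n → ℝ) → ℝ) {b x : Fin n → ℝ} {t : ℝ}
    (ht : 0 < t) (hx : x ∈ icoBox b t) :
    (∫⁻ y in icoBox b t, ENNReal.ofReal |g y|) / volume (icoBox b t) ≤ maximal g x := by
  have hlim : Filter.Tendsto (fun ε : ℝ => (∫⁻ y in icoBox b t, ENNReal.ofReal |g y|) /
      ENNReal.ofReal (t + ε) ^ n) (nhdsWithin 0 (Set.Ioi 0))
      (nhds ((∫⁻ y in icoBox b t, ENNReal.ofReal |g y|) / ENNReal.ofReal t ^ n)) := by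
    refine Filter.Tendsto.mono_left ?_ nhdsWithin_le_nhds
    refine ENNReal.Tendsto.const_div ?_ (Or.inl (by finiteness))
    refine ENNReal.Tendsto.pow (ENNReal.tendsto_ofReal ?_)
    have : ContinuousAt (fun ε : ℝ => t + ε) 0 := by fun_prop
    simpa [ContinuousAt] using this
  rw [volume_icoBox]
  refine le_of_tendsto hlim ?_
  filter_upwards [self_mem_nhdsWithin] with ε hε
  have hε : 0 < ε := hε
  have hsub : icoBox b t ⊆ cube (fun i => b i - ε) (t + ε) := by
    refine Set.pi_mono fun i _ y hy => ⟨?_, ?_⟩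
    · linarith [hy.1]
    · linarith [hy.2]
  calc (∫⁻ y in icoBox b t, ENNReal.ofReal |g y|) / ENNReal.ofReal (t + ε) ^ n
      ≤ (∫⁻ y in cube (fun i => b i - ε) (t + ε), ENNReal.ofReal |g y|) /
          volume (cube (fun i => b i - ε) (t + ε)) := by
        rw [volume_cube]
        exact ENNReal.div_le_div_right (lintegral_mono_set hsub) _
    _ ≤ maximal g x :=
        le_iSup_of_le _ (le_iSup_of_le ⟨_, _, by positivity, rfl⟩
          (le_iSup_of_le (hsub hx) le_rfl))

theorem setLIntegral_abs_indicator_cube {n : ℕ} {w : (Fin n → ℝ) → ℝ} (hw : ∀ x, 0 ≤ w x)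
    (b : Fin n → ℝ) (t : ℝ) {T : Set (Fin n → ℝ)} (hT : MeasurableSet T)
    (hTb : T ⊆ icoBox b t) :
    ∫⁻ y in T, ENNReal.ofReal |(cube b t).indicator w y| = ∫⁻ y in T, ENNReal.ofReal (w y) := by
  have h1 : (cube b t).indicator w =ᵐ[volume] (icoBox b t).indicator w :=
    indicator_ae_eq_of_ae_eq_set (cube_ae_eq_icoBox b t)
  refine setLIntegral_congr_fun_ae hT ?_
  filter_upwards [h1] with y hy hyT
  rw [hy, Set.indicator_of_mem (hTb hyT), abs_of_nonneg (hw y)]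

theorem integrableOn_icoBox {n : ℕ} {w : (Fin n → ℝ) → ℝ} (hloc : LocallyIntegrable w volume)
    (b : Fin n → ℝ) (t : ℝ) : IntegrableOn w (icoBox b t) volume := by
  refine (hloc.integrableOn_isCompact
    (isCompact_univ_pi fun i => isCompact_Icc (a := b i) (b := b i + t))).mono_set ?_
  exact Set.pi_mono fun i _ => Set.Ico_subset_Icc_self

theorem ofReal_setIntegral_icoBox {n : ℕ} {w : (Fin n → ℝ) → ℝ} (hw : ∀ x, 0 ≤ w x)
    (hloc : LocallyIntegrable w volume) (b : Fin n → ℝ) (t : ℝ) :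
    ENNReal.ofReal (∫ y in icoBox b t, w y) = ∫⁻ y in icoBox b t, ENNReal.ofReal (w y) :=
  ofReal_integral_eq_lintegral_ofReal (integrableOn_icoBox hloc b t)
    (Filter.Eventually.of_forall hw)

/-- The mass of a continuously moving cube is a continuous function. -/
theorem continuousOn_setIntegral_icoBox {n : ℕ} {w : (Fin n → ℝ) → ℝ}
    (hloc : LocallyIntegrable w volume) {p : ℝ → Fin n → ℝ} (hp : Continuous p) {B : Set ℝ}
    {q : Fin n → ℝ} {r : ℝ} (hB : ∀ t ∈ B, icoBox (p t) t ⊆ icoBox q r) :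
    ContinuousOn (fun t => ∫ y in icoBox (p t) t, w y) B := by
  have hrw : (fun t => ∫ y in icoBox (p t) t, w y) =
      fun t => ∫ y, (icoBox (p t) t).indicator w y := by
    funext t
    rw [integral_indicator (measurableSet_icoBox _ _)]
  rw [hrw]
  intro t₀ _
  refine continuousWithinAt_of_dominated (bound := (icoBox q r).indicator fun y => ‖w y‖)
    ?_ ?_ ?_ ?_
  · exact Filter.Eventually.of_forall fun t =>
      hloc.aestronglyMeasurable.indicator (measurableSet_icoBox _ _)
  · filter_upwards [self_mem_nhdsWithin] with t ht
    refine Filter.Eventually.of_forall fun y => ?_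
    rw [norm_indicator_eq_indicator_norm]
    exact Set.indicator_le_indicator_of_subset (hB t ht) (fun _ => norm_nonneg _) y
  · exact (integrable_indicator_iff (measurableSet_icoBox q r)).2 (integrableOn_icoBox hloc q r).norm
  · have hne : ∀ᵐ y : Fin n → ℝ, ∀ i, y i ≠ p t₀ i ∧ y i ≠ p t₀ i + t₀ := by
      refine ae_all_iff.2 fun i => ?_
      have h1 : ∀ c : ℝ, ∀ᵐ y : Fin n → ℝ, y i ≠ c := fun c => by
        rw [ae_iff, volume_pi]
        simpa using Measure.pi_hyperplane (fun _ : Fin n => (volume : Measure ℝ)) i c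
      exact (h1 _).and (h1 _)
    filter_upwards [hne] with y hy
    refine ContinuousAt.continuousWithinAt ?_
    have hpi : ∀ i, Continuous fun t => p t i := fun i => (continuous_apply i).comp hp
    have hev : ∀ᶠ t in nhds t₀, ∀ i,
        (y i ∈ Set.Ico (p t i) (p t i + t) ↔ y i ∈ Set.Ico (p t₀ i) (p t₀ i + t₀)) := by
      refine Filter.eventually_all.2 fun i => ?_
      have e1 : ∀ᶠ t in nhds t₀, (p t i ≤ y i ↔ p t₀ i ≤ y i) := by
        rcases lt_or_gt_of_ne (hy i).1 with h | h
        · filter_upwards [(hpi i).continuousAt.eventually_const_lt h] with t ht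
          exact iff_of_false ht.not_ge h.not_ge
        · filter_upwards [(hpi i).continuousAt.eventually_lt_const h] with t ht
          exact iff_of_true ht.le h.le
      have e2 : ∀ᶠ t in nhds t₀, (y i < p t i + t ↔ y i < p t₀ i + t₀) := by
        have hc : Continuous fun t => p t i + t := (hpi i).add continuous_id
        rcases lt_or_gt_of_ne (hy i).2 with h | h
        · filter_upwards [hc.continuousAt.eventually_const_lt h] with t ht
          exact iff_of_true ht h
        · filter_upwards [hc.continuousAt.eventually_lt_const h] with t ht
          exact iff_of_false ht.not_gt h.not_gt
      filter_upwards [e1, e2] with t h1 h2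
      exact and_congr h1 h2
    refine ContinuousAt.congr (f := fun _ => (icoBox (p t₀) t₀).indicator w y)
      continuousAt_const ?_
    filter_upwards [hev] with t ht
    have hiff : y ∈ icoBox (p t) t ↔ y ∈ icoBox (p t₀) t₀ := by
      simp only [icoBox, Set.mem_univ_pi]
      exact forall_congr' ht
    by_cases h : y ∈ icoBox (p t₀) t₀
    · rw [Set.indicator_of_mem h, Set.indicator_of_mem (hiff.2 h)]
    · rw [Set.indicator_of_notMem h, Set.indicator_of_notMem (mt hiff.1 h)]

/-- Between a cube of large average and a cube of twice its side of small average there is a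
cube whose average is exactly the prescribed level. -/
theorem exists_icoBox_average_eq {n : ℕ} {w : (Fin n → ℝ) → ℝ} (hw : ∀ x, 0 ≤ w x)
    (hloc : LocallyIntegrable w volume) {b e : Fin n → ℝ} (he : ∀ i, 0 ≤ e i ∧ e i ≤ 1)
    {h : ℝ} (hh : 0 < h) {lam : ℝ≥0∞} (hlam : lam ≠ ∞)
    (hS : lam ≤ (∫⁻ y in icoBox b h, ENNReal.ofReal (w y)) / volume (icoBox b h))
    (hP : (∫⁻ y in icoBox (fun i => b i - e i * h) (2 * h), ENNReal.ofReal (w y)) /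
      volume (icoBox (fun i => b i - e i * h) (2 * h)) ≤ lam) :
    ∃ (p : Fin n → ℝ) (t : ℝ), h ≤ t ∧ t ≤ 2 * h ∧ icoBox b h ⊆ icoBox p t ∧
      ∫⁻ y in icoBox p t, ENNReal.ofReal (w y) = lam * volume (icoBox p t) := by
  lift lam to NNReal using hlam
  set p : ℝ → Fin n → ℝ := fun t i => b i - e i * (t - h) with hp_def
  have hp : Continuous p := by fun_prop
  have hmono : ∀ t u, t ≤ u → icoBox (p t) t ⊆ icoBox (p u) u := fun t u htu =>
    icoBox_subset_icoBox
      (fun i => by simp only [hp_def]; nlinarith [(he i).1])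
      (fun i => by simp only [hp_def]; nlinarith [(he i).2])
  have hph : p h = b := by funext i; simp [hp_def]
  have hp2 : p (2 * h) = fun i => b i - e i * h := by funext i; simp only [hp_def]; ring
  have hcont : ContinuousOn (fun t => (∫ y in icoBox (p t) t, w y) - lam * t ^ n)
      (Set.Icc h (2 * h)) :=
    (continuousOn_setIntegral_icoBox hloc hp fun t ht => hmono t (2 * h) ht.2).sub (by fun_prop)
  have hvol : ∀ t : ℝ, 0 < t → (lam : ℝ≥0∞) * ENNReal.ofReal t ^ n =
      ENNReal.ofReal (lam * t ^ n) := fun t ht => by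
    rw [ENNReal.ofReal_mul (by positivity), ENNReal.ofReal_pow ht.le, ENNReal.ofReal_coe_nnreal]
  have hne : ∀ t : ℝ, 0 < t → ENNReal.ofReal t ^ n ≠ 0 := fun t ht =>
    pow_ne_zero _ (ENNReal.ofReal_pos.2 ht).ne'
  have hleft : 0 ≤ (∫ y in icoBox (p h) h, w y) - lam * h ^ n := by
    rw [volume_icoBox, ENNReal.le_div_iff_mul_le (Or.inl (hne h hh)) (Or.inl (by finiteness)),
      hvol h hh, ← ofReal_setIntegral_icoBox hw hloc,
      ENNReal.ofReal_le_ofReal_iff (integral_nonneg hw)] at hS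
    rw [hph]
    linarith
  have hright : (∫ y in icoBox (p (2 * h)) (2 * h), w y) - lam * (2 * h) ^ n ≤ 0 := by
    have h2 : 0 < 2 * h := by linarith
    rw [volume_icoBox, ENNReal.div_le_iff (hne _ h2) (by finiteness),
      hvol _ h2, ← ofReal_setIntegral_icoBox hw hloc,
      ENNReal.ofReal_le_ofReal_iff (by positivity)] at hP
    rw [hp2]
    linarith
  obtain ⟨t, ht, ht0⟩ := intermediate_value_Icc' (by linarith : h ≤ 2 * h) hcont ⟨hright, hleft⟩
  refine ⟨p t, t, ht.1, ht.2, ?_, ?_⟩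
  · have := hmono h t ht.1
    rwa [hph] at this
  · rw [volume_icoBox, hvol t (by linarith [ht.1]), ← ofReal_setIntegral_icoBox hw hloc]
    congr 1
    simp only at ht0
    linarith

/-- The Fujii–Wilson condition on a cube of average `lam` controls the maximal function on a
subcube of comparable size. -/
theorem setLIntegral_maximal_le_of_average_eq {n : ℕ} {w : (Fin n → ℝ) → ℝ}
    (hw : ∀ x, 0 ≤ w x) {δ : ℝ} (hδ : 1 < δ)
    (hFW : ∀ Q' : Set (Fin n → ℝ), IsCube Q' →
      (∫⁻ x in Q', maximal (Q'.indicator w) x) ≤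
        ENNReal.ofReal δ * ∫⁻ x in Q', ENNReal.ofReal (w x))
    {b p : Fin n → ℝ} {h t : ℝ} (hh : 0 < h) (hht : h ≤ t) (ht2 : t ≤ 2 * h)
    (hsub : icoBox b h ⊆ icoBox p t) {lam : ℝ≥0∞} (hlam : lam ≠ ∞)
    (havg : ∫⁻ y in icoBox p t, ENNReal.ofReal (w y) = lam * volume (icoBox p t)) :
    ∫⁻ x in icoBox b h, maximal ((cube p t).indicator w) x ≤
      ENNReal.ofReal (δ + (2 ^ n - 1) * (δ - 1)) * lam * volume (icoBox b h) := by
  have ht : 0 < t := hh.trans_le hht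
  have hR := hFW (cube p t) ⟨p, t, ht, rfl⟩
  rw [setLIntegral_congr (cube_ae_eq_icoBox p t), setLIntegral_congr (cube_ae_eq_icoBox p t),
    havg, ← lintegral_inter_add_sdiff _ (icoBox p t) (measurableSet_icoBox b h),
    Set.inter_eq_self_of_subset_right hsub] at hR
  have hdiff : lam * volume (icoBox p t \ icoBox b h) ≤
      ∫⁻ x in icoBox p t \ icoBox b h, maximal ((cube p t).indicator w) x := by
    rw [← setLIntegral_const]
    refine setLIntegral_mono' ((measurableSet_icoBox p t).diff (measurableSet_icoBox b h))
      fun x hx => ?_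
    refine le_trans ?_ (average_icoBox_le_maximal _ ht hx.1)
    rw [setLIntegral_abs_indicator_cube hw p t (measurableSet_icoBox p t) subset_rfl, havg,
      volume_icoBox, ENNReal.mul_div_cancel_right
        (pow_ne_zero _ (ENNReal.ofReal_pos.2 ht).ne') (by finiteness)]
  have hX := (add_le_add_right hdiff _).trans hR
  set X := ∫⁻ x in icoBox b h, maximal ((cube p t).indicator w) x with hXdef
  lift lam to NNReal using hlam
  rw [measure_sdiff hsub (measurableSet_icoBox b h).nullMeasurableSet
    (by rw [volume_icoBox]; finiteness)] at hX
  simp only [volume_icoBox] at hX ⊢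
  have hXtop : X ≠ ∞ := by
    refine ne_top_of_le_ne_top ?_ (le_self_add.trans hX)
    finiteness
  have hXr : X = ENNReal.ofReal X.toReal := (ENNReal.ofReal_toReal hXtop).symm
  have hpow : h ^ n ≤ t ^ n := pow_le_pow_left₀ hh.le hht n
  have hpow2 : t ^ n ≤ 2 ^ n * h ^ n := by
    rw [← mul_pow]; exact pow_le_pow_left₀ ht.le ht2 n
  have h2n : (1 : ℝ) ≤ 2 ^ n := one_le_pow₀ (by norm_num)
  have hc : 0 ≤ δ + (2 ^ n - 1) * (δ - 1) := by nlinarith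
  have hl : (0 : ℝ) ≤ lam := lam.2
  rw [hXr, ← ENNReal.ofReal_coe_nnreal, ← ENNReal.ofReal_pow hh.le, ← ENNReal.ofReal_pow ht.le,
    ← ENNReal.ofReal_sub _ (by positivity), ← ENNReal.ofReal_mul hl, ← ENNReal.ofReal_mul hl,
    ← ENNReal.ofReal_mul (by linarith),
    ← ENNReal.ofReal_add ENNReal.toReal_nonneg (mul_nonneg hl (by linarith)),
    ENNReal.ofReal_le_ofReal_iff (by positivity)] at hX
  rw [hXr, ← ENNReal.ofReal_coe_nnreal, ← ENNReal.ofReal_pow hh.le, ← ENNReal.ofReal_mul hc,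
    ← ENNReal.ofReal_mul (by positivity)]
  refine ENNReal.ofReal_le_ofReal ?_
  nlinarith [mul_le_mul_of_nonneg_left hpow2 (mul_nonneg hl (by linarith : 0 ≤ δ - 1))]

theorem Mdyadic_le_maximal {n : ℕ} (a : Fin n → ℝ) {s : ℝ} (hs : 0 < s)
    (f : (Fin n → ℝ) → ℝ) (x : Fin n → ℝ) : Mdyadic a s f x ≤ maximal f x := by
  refine iSup_le fun k => iSup_le fun j => iSup_le fun _ => iSup_le fun hx => ?_
  rw [dyadicCube_eq_icoBox] at hx ⊢
  exact average_icoBox_le_maximal f (by positivity) hx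

/-- The average of `|f|` over a dyadic subcube. -/
def dyadicAverage {n : ℕ} (a : Fin n → ℝ) (s : ℝ) (f : (Fin n → ℝ) → ℝ) (k : ℕ)
    (j : Fin n → ℕ) : ℝ≥0∞ :=
  (∫⁻ y in dyadicCube a s k j, ENNReal.ofReal |f y|) / volume (dyadicCube a s k j)

/-- A stopping cube at level `lam`: a maximal dyadic subcube of average larger than `lam`. -/
def IsStopping {n : ℕ} (a : Fin n → ℝ) (s : ℝ) (f : (Fin n → ℝ) → ℝ) (lam : ℝ≥0∞) (k : ℕ)
    (j : Fin n → ℕ) : Prop :=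
  (∀ i, j i < 2 ^ k) ∧ lam < dyadicAverage a s f k j ∧
    ∀ l m, l + m = k → 0 < m → dyadicAverage a s f l (fun i => j i / 2 ^ m) ≤ lam

theorem lt_Mdyadic_iff {n : ℕ} {a : Fin n → ℝ} {s : ℝ} (hs : 0 < s) {f : (Fin n → ℝ) → ℝ}
    {lam : ℝ≥0∞} {x : Fin n → ℝ} :
    lam < Mdyadic a s f x ↔
      ∃ k j, IsStopping a s f lam k j ∧ x ∈ dyadicCube a s k j := by
  classical
  constructor
  · intro hx
    have hex : ∃ k, ∃ j : Fin n → ℕ, (∀ i, j i < 2 ^ k) ∧ x ∈ dyadicCube a s k j ∧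
        lam < dyadicAverage a s f k j := by
      simp only [Mdyadic, lt_iSup_iff] at hx
      obtain ⟨k, j, hj, hxj, hl⟩ := hx
      exact ⟨k, j, hj, hxj, hl⟩
    obtain ⟨j, hj, hxj, hl⟩ := Nat.find_spec hex
    refine ⟨Nat.find hex, j, ⟨hj, hl, fun l m hlm hm => ?_⟩, hxj⟩
    by_contra! hcon
    refine Nat.find_min hex (m := l) (by omega) ⟨_, fun i => ?_, ?_, hcon⟩
    · rw [Nat.div_lt_iff_lt_mul (by positivity), ← pow_add, hlm]
      exact hj i
    · rw [← hlm] at hxj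
      exact dyadicCube_subset_ancestor a hs l m j hxj
  · rintro ⟨k, j, ⟨hj, hl, -⟩, hxj⟩
    exact hl.trans_le (le_iSup_of_le k (le_iSup_of_le j (le_iSup_of_le hj
      (le_iSup_of_le hxj le_rfl))))

theorem IsStopping.eq_of_mem {n : ℕ} {a : Fin n → ℝ} {s : ℝ} (hs : 0 < s)
    {f : (Fin n → ℝ) → ℝ} {lam : ℝ≥0∞} {x : Fin n → ℝ} {k k' : ℕ} {j j' : Fin n → ℕ}
    (h : IsStopping a s f lam k j) (h' : IsStopping a s f lam k' j')
    (hx : x ∈ dyadicCube a s k j) (hx' : x ∈ dyadicCube a s k' j') : k = k' ∧ j = j' := by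
  have key : ∀ {k k' : ℕ} {j j' : Fin n → ℕ}, IsStopping a s f lam k j →
      IsStopping a s f lam k' j' → x ∈ dyadicCube a s k j → x ∈ dyadicCube a s k' j' →
      ¬ k < k' := by
    intro k k' j j' h h' hx hx' hlt
    obtain ⟨m, rfl⟩ := Nat.exists_eq_add_of_lt hlt
    rw [add_assoc] at h' hx'
    have := index_unique hs hx (dyadicCube_subset_ancestor a hs k (m + 1) j' hx')
    subst this
    exact absurd (h'.2.2 k (m + 1) rfl (by omega)) h.2.1.not_ge
  have hk : k = k' := le_antisymm (not_lt.1 (key h' h hx' hx)) (not_lt.1 (key h h' hx hx'))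
  subst hk
  exact ⟨rfl, index_unique hs hx hx'⟩

/-- On a stopping cube, the local dyadic maximal function only sees the part of the weight that
lives on a given cube containing the stopping cube. -/
theorem IsStopping.Mdyadic_le_maximal {n : ℕ} {w : (Fin n → ℝ) → ℝ} (hw : ∀ x, 0 ≤ w x)
    {a : Fin n → ℝ} {s : ℝ} (hs : 0 < s) {lam : ℝ≥0∞} {k : ℕ} {j : Fin n → ℕ}
    (hst : IsStopping a s ((cube a s).indicator w) lam k j) {p : Fin n → ℝ} {t : ℝ}
    (hsub : dyadicCube a s k j ⊆ icoBox p t) {x : Fin n → ℝ} (hx : x ∈ dyadicCube a s k j) :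
    Mdyadic a s ((cube a s).indicator w) x ≤ maximal ((cube p t).indicator w) x := by
  have hsmall : ∀ k' j', (∀ i, j' i < 2 ^ k') → dyadicCube a s k' j' ⊆ dyadicCube a s k j →
      x ∈ dyadicCube a s k' j' →
      dyadicAverage a s ((cube a s).indicator w) k' j' ≤
        maximal ((cube p t).indicator w) x := by
    intro k' j' hj' hss hx'
    have hm : MeasurableSet (dyadicCube a s k' j') := by
      rw [dyadicCube_eq_icoBox]; exact measurableSet_icoBox _ _
    rw [dyadicAverage, setLIntegral_abs_indicator_cube hw a s hm
      (dyadicCube_subset_icoBox a hs k' j' hj'),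
      ← setLIntegral_abs_indicator_cube hw p t hm (hss.trans hsub)]
    rw [dyadicCube_eq_icoBox] at hx' ⊢
    exact average_icoBox_le_maximal _ (by positivity) hx'
  refine iSup_le fun k' => iSup_le fun j' => iSup_le fun hj' => iSup_le fun hx' => ?_
  change dyadicAverage a s ((cube a s).indicator w) k' j' ≤ _
  rcases lt_or_ge k' k with hlt | hge
  · obtain ⟨m, rfl⟩ := Nat.exists_eq_add_of_lt hlt
    rw [add_assoc] at hst hx hsmall
    have := index_unique hs hx' (dyadicCube_subset_ancestor a hs k' (m + 1) j hx)
    subst this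
    exact (hst.2.2 k' (m + 1) rfl (by omega)).trans
      (hst.2.1.le.trans (hsmall _ _ hst.1 subset_rfl hx))
  · obtain ⟨m, rfl⟩ := Nat.exists_eq_add_of_le hge
    have hanc := dyadicCube_subset_ancestor a hs k m j'
    have := index_unique hs hx (hanc hx')
    subst this
    exact hsmall _ _ hj' hanc hx'

theorem IsStopping.setLIntegral_Mdyadic_le {n : ℕ} {w : (Fin n → ℝ) → ℝ}
    (hw : ∀ x, 0 ≤ w x) (hloc : LocallyIntegrable w volume) {δ : ℝ} (hδ : 1 < δ)
    (hFW : ∀ Q' : Set (Fin n → ℝ), IsCube Q' →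
      (∫⁻ x in Q', maximal (Q'.indicator w) x) ≤
        ENNReal.ofReal δ * ∫⁻ x in Q', ENNReal.ofReal (w x))
    {a : Fin n → ℝ} {s : ℝ} (hs : 0 < s) {lam : ℝ≥0∞}
    (hlam : (∫⁻ x in cube a s, maximal ((cube a s).indicator w) x) /
        (ENNReal.ofReal δ * volume (cube a s)) ≤ lam) {k : ℕ} {j : Fin n → ℕ}
    (hst : IsStopping a s ((cube a s).indicator w) lam k j) :
    ∫⁻ x in dyadicCube a s k j, Mdyadic a s ((cube a s).indicator w) x ≤
      ENNReal.ofReal (δ + (2 ^ n - 1) * (δ - 1)) * lam * volume (dyadicCube a s k j) := by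
  have hδpos : 0 < δ := by linarith
  rcases k with _ | k
  · have hj : j = fun _ => 0 := by
      funext i
      simpa using hst.1 i
    have hne : ENNReal.ofReal δ * volume (cube a s) ≠ 0 := by
      rw [volume_cube]
      exact mul_ne_zero (ENNReal.ofReal_pos.2 hδpos).ne'
        (pow_ne_zero _ (ENNReal.ofReal_pos.2 hs).ne')
    rw [ENNReal.div_le_iff hne (by rw [volume_cube]; finiteness)] at hlam
    have h2n : (1 : ℝ) ≤ 2 ^ n := one_le_pow₀ (by norm_num)
    rw [hj, dyadicCube_zero, ← setLIntegral_congr (cube_ae_eq_icoBox a s),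
      ← measure_congr (cube_ae_eq_icoBox a s)]
    calc ∫⁻ x in cube a s, Mdyadic a s ((cube a s).indicator w) x
        ≤ ∫⁻ x in cube a s, maximal ((cube a s).indicator w) x :=
          lintegral_mono fun x => _root_.Mdyadic_le_maximal a hs _ x
      _ ≤ lam * (ENNReal.ofReal δ * volume (cube a s)) := hlam
      _ = ENNReal.ofReal δ * lam * volume (cube a s) := by ring
      _ ≤ _ := by
          gcongr
          nlinarith
  · have hltop : lam ≠ ∞ := (hst.2.1.trans_le le_top).ne
    have hpar := hst.2.2 k 1 rfl one_pos
    have hself := hst.2.1.le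
    have hjpar : ∀ i, j i / 2 ^ 1 < 2 ^ k := fun i => by
      have := hst.1 i
      rw [pow_succ] at this
      omega
    have hm : ∀ k j, MeasurableSet (dyadicCube a s k j) := fun k j => by
      rw [dyadicCube_eq_icoBox]; exact measurableSet_icoBox _ _
    rw [dyadicAverage, setLIntegral_abs_indicator_cube hw a s (hm _ _)
      (dyadicCube_subset_icoBox a hs _ _ hjpar)] at hpar
    rw [dyadicAverage, setLIntegral_abs_indicator_cube hw a s (hm _ _)
      (dyadicCube_subset_icoBox a hs _ _ hst.1)] at hself
    set b : Fin n → ℝ := fun i => a i + s * (j i : ℝ) / 2 ^ (k + 1) with hb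
    set h : ℝ := s / 2 ^ (k + 1) with hh_def
    have hh : 0 < h := by positivity
    have hS : dyadicCube a s (k + 1) j = icoBox b h := dyadicCube_eq_icoBox _ _ _ _
    have hP : dyadicCube a s k (fun i => j i / 2 ^ 1) =
        icoBox (fun i => b i - ((j i % 2 : ℕ) : ℝ) * h) (2 * h) := by
      rw [dyadicCube_eq_icoBox]
      congr 1
      · funext i
        have hji : (j i : ℝ) = 2 * ((j i / 2 : ℕ) : ℝ) + ((j i % 2 : ℕ) : ℝ) := by
          exact_mod_cast (Nat.div_add_mod (j i) 2).symm
        simp only [hb, hh_def, pow_one]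
        rw [hji, pow_succ]
        field_simp
        ring
      · rw [hh_def, pow_succ]
        field_simp
    rw [hS] at hself
    rw [hP] at hpar
    have he : ∀ i, 0 ≤ ((j i % 2 : ℕ) : ℝ) ∧ ((j i % 2 : ℕ) : ℝ) ≤ 1 := fun i =>
      ⟨Nat.cast_nonneg _, by exact_mod_cast Nat.lt_succ_iff.1 (Nat.mod_lt (j i) two_pos)⟩
    obtain ⟨p, t, hht, ht2, hsub, havg⟩ :=
      exists_icoBox_average_eq hw hloc he hh hltop hself hpar
    have hbound := setLIntegral_maximal_le_of_average_eq hw hδ hFW hh hht ht2 hsub hltop havg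
    rw [← hS] at hbound hsub
    exact (setLIntegral_mono' (hm _ _) fun x hx =>
      hst.Mdyadic_le_maximal hw hs hsub hx).trans hbound

/-- The key superlevel-set estimate in `ℝⁿ`: for an `A∞` weight with Fujii–Wilson
constant at most `δ`, a cube `Q`, `λ₀ = (∫_Q M(w·1_Q))/(δ|Q|)` and
`c_n(δ) = δ + (2ⁿ-1)(δ-1)`, one has, for every `λ ≥ λ₀`,
`∫_{E_λ} M_Q(w·1_Q) ≤ c_n(δ) λ |E_λ|`, where `E_λ = {x ∈ Q : M_Q(w·1_Q)(x) > λ}`. -/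
theorem stmt18 {n : ℕ} (w : (Fin n → ℝ) → ℝ) (hw : ∀ x, 0 ≤ w x)
    (hloc : LocallyIntegrable w volume) (δ : ℝ) (hδ : 1 < δ)
    (hFW : ∀ Q' : Set (Fin n → ℝ), IsCube Q' →
      (∫⁻ x in Q', maximal (Q'.indicator w) x) ≤
        ENNReal.ofReal δ * ∫⁻ x in Q', ENNReal.ofReal (w x))
    (a : Fin n → ℝ) (s : ℝ) (hs : 0 < s) (lam : ℝ≥0∞)
    (hlam : (∫⁻ x in cube a s, maximal ((cube a s).indicator w) x) /
        (ENNReal.ofReal δ * volume (cube a s)) ≤ lam) :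
    (∫⁻ x in {x ∈ cube a s | lam < Mdyadic a s ((cube a s).indicator w) x},
        Mdyadic a s ((cube a s).indicator w) x) ≤
      ENNReal.ofReal (δ + (2 ^ n - 1) * (δ - 1)) * lam *
        volume {x ∈ cube a s | lam < Mdyadic a s ((cube a s).indicator w) x} := by
  set f := (cube a s).indicator w with hf
  set C := ENNReal.ofReal (δ + (2 ^ n - 1) * (δ - 1)) with hC
  let ι := {q : ℕ × (Fin n → ℕ) // IsStopping a s f lam q.1 q.2}
  let S : ι → Set (Fin n → ℝ) := fun q => dyadicCube a s q.1.1 q.1.2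
  have hSm : ∀ q, MeasurableSet (S q) := fun q => by
    simp only [S, dyadicCube_eq_icoBox]
    exact measurableSet_icoBox _ _
  have hcube : MeasurableSet (cube a s) := MeasurableSet.univ_pi fun _ => measurableSet_Ioo
  have hE : {x ∈ cube a s | lam < Mdyadic a s f x} = ⋃ q : ι, S q ∩ cube a s := by
    ext x
    simp only [Set.mem_ofPred_eq, Set.mem_iUnion, lt_Mdyadic_iff hs]
    constructor
    · rintro ⟨hx, k, j, hst, hxj⟩
      exact ⟨⟨(k, j), hst⟩, hxj, hx⟩
    · rintro ⟨⟨⟨k, j⟩, hst⟩, hxj, hx⟩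
      exact ⟨hx, k, j, hst, hxj⟩
  have hdisj : Pairwise (Function.onFun Disjoint fun q : ι => S q ∩ cube a s) := by
    intro q q' hne
    refine Set.disjoint_left.2 fun x hx hx' => hne ?_
    obtain ⟨h1, h2⟩ := IsStopping.eq_of_mem hs q.2 q'.2 hx.1 hx'.1
    exact Subtype.ext (Prod.ext h1 h2)
  have hvol : ∀ q : ι, volume (S q ∩ cube a s) = volume (S q) := fun q => by
    have h := (Filter.EventuallyEq.refl (ae volume) (S q)).inter (cube_ae_eq_icoBox a s)
    rw [measure_congr h, Set.inter_eq_self_of_subset_left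
      (dyadicCube_subset_icoBox a hs _ _ q.2.1)]
  rw [hE]
  calc ∫⁻ x in ⋃ q : ι, S q ∩ cube a s, Mdyadic a s f x
      ≤ ∑' q : ι, ∫⁻ x in S q ∩ cube a s, Mdyadic a s f x := lintegral_iUnion_le _ _
    _ ≤ ∑' q : ι, C * lam * volume (S q ∩ cube a s) := by
        refine ENNReal.tsum_le_tsum fun q => ?_
        rw [hvol q]
        exact (lintegral_mono_set Set.inter_subset_left).trans
          (q.2.setLIntegral_Mdyadic_le hw hloc hδ hFW hs hlam)
    _ = C * lam * volume (⋃ q : ι, S q ∩ cube a s) := by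
        rw [ENNReal.tsum_mul_left, measure_iUnion hdisj fun q => (hSm q).inter hcube]
end
end

section
/- Let w be a weight on ℝⁿ and let δ > 1. Assume the Fujii–Wilson condition with constant δ: for every bounded axis-parallel cube Q′, ∫_{Q′} M(w·1_{Q′}) dx ≤ δ·w(Q′). Then for every bounded axis-parallel cube Q and every r with 1 ≤ r < 1 + 1/(2ⁿ(δ−1)), one has (1/|Q|)∫_Q M_Q(w·1_Q)ʳ dx ≤ δ^{1−r} · (r′−1)/(r′−1−2ⁿ(δ−1)) · ((1/|Q|)∫_Q M_Q(w·1_Q) dx)ʳ. -/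
open MeasureTheory Set ENNReal

noncomputable section

/-- The half-open cube with corner `a` and side length `s`. -/
def halfOpenCube {n : ℕ} (a : Fin n → ℝ) (s : ℝ) : Set (Fin n → ℝ) :=
  Set.univ.pi fun i => Set.Ico (a i) (a i + s)

/-- The corner of the dyadic child with index `e` of the cube with corner `a` and side `s`. -/
def childCorner {n : ℕ} (a : Fin n → ℝ) (s : ℝ) (e : Fin n → Fin 2) : Fin n → ℝ :=
  fun i => a i + s / 2 * ((e i : ℕ) : ℝ)

/-- The average of `g` over a half-open cube. -/
def cubeAvg {n : ℕ} (g : (Fin n → ℝ) → ℝ≥0∞) (a : Fin n → ℝ) (s : ℝ) : ℝ≥0∞ :=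
  (∫⁻ y in halfOpenCube a s, g y) / volume (halfOpenCube a s)

/-- The local dyadic maximal function restricted to the first `d` generations. -/
def truncMax {n : ℕ} (g : (Fin n → ℝ) → ℝ≥0∞) :
    ℕ → (Fin n → ℝ) → ℝ → (Fin n → ℝ) → ℝ≥0∞
  | 0, a, s, _ => cubeAvg g a s
  | d + 1, a, s, x => max (cubeAvg g a s)
      (⨆ e : Fin n → Fin 2, (halfOpenCube (childCorner a s e) (s / 2)).indicator
        (truncMax g d (childCorner a s e) (s / 2)) x)

section Cubes

variable {n : ℕ}

lemma measurableSet_halfOpenCube (a : Fin n → ℝ) (s : ℝ) :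
    MeasurableSet (halfOpenCube a s) :=
  MeasurableSet.univ_pi fun _ => measurableSet_Ico

lemma volume_halfOpenCube (a : Fin n → ℝ) (s : ℝ) :
    volume (halfOpenCube a s) = ENNReal.ofReal s ^ n := by
  simp [halfOpenCube, Real.volume_pi_Ico]

lemma volume_halfOpenCube_ne_zero (a : Fin n → ℝ) {s : ℝ} (hs : 0 < s) :
    volume (halfOpenCube a s) ≠ 0 := by
  rw [volume_halfOpenCube]
  exact pow_ne_zero _ (by simpa using hs)

lemma volume_halfOpenCube_ne_top (a : Fin n → ℝ) (s : ℝ) :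
    volume (halfOpenCube a s) ≠ ∞ := by
  rw [volume_halfOpenCube]
  exact ENNReal.pow_ne_top ENNReal.ofReal_ne_top

lemma volume_halfOpenCube_eq_child (a b : Fin n → ℝ) (s : ℝ) :
    volume (halfOpenCube a s) = 2 ^ n * volume (halfOpenCube b (s / 2)) := by
  rw [volume_halfOpenCube, volume_halfOpenCube, ← mul_pow]
  congr 1
  rw [show (2 : ℝ≥0∞) = ENNReal.ofReal 2 by simp, ← ENNReal.ofReal_mul (by norm_num)]
  congr 1
  ring

lemma cube_ae_eq_halfOpenCube (a : Fin n → ℝ) (s : ℝ) :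
    cube a s =ᵐ[volume] halfOpenCube a s :=
  Measure.univ_pi_Ioo_ae_eq_Icc.trans Measure.univ_pi_Ico_ae_eq_Icc.symm

lemma dyadicCube_eq_halfOpenCube (a : Fin n → ℝ) (s : ℝ) (k : ℕ) (j : Fin n → ℕ) :
    dyadicCube a s k j = halfOpenCube (fun i => a i + s * (j i : ℝ) / 2 ^ k) (s / 2 ^ k) := by
  unfold dyadicCube halfOpenCube
  congr 1
  ext i : 1
  congr 1
  ring

lemma dyadicCube_zero_zero (a : Fin n → ℝ) (s : ℝ) :
    dyadicCube a s 0 (fun _ => 0) = halfOpenCube a s := by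
  simp [dyadicCube, halfOpenCube]

lemma dyadicCube_child (a : Fin n → ℝ) (s : ℝ) (e : Fin n → Fin 2) (k : ℕ) (j : Fin n → ℕ) :
    dyadicCube (childCorner a s e) (s / 2) k j =
      dyadicCube a s (k + 1) (fun i => 2 ^ k * (e i : ℕ) + j i) := by
  have h2 : (2 : ℝ) ^ k ≠ 0 := by positivity
  unfold dyadicCube childCorner
  congr 1
  ext i : 1
  push_cast
  congr 1 <;> rw [pow_succ] <;> field_simp <;> ring

lemma dyadicCube_subset (a : Fin n → ℝ) {s : ℝ} (hs : 0 < s) (k : ℕ) {j : Fin n → ℕ}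
    (hj : ∀ i, j i < 2 ^ k) : dyadicCube a s k j ⊆ halfOpenCube a s := by
  refine Set.pi_mono fun i _ => Set.Ico_subset_Ico ?_ ?_
  · have : 0 ≤ s * (j i : ℝ) / 2 ^ k := by positivity
    linarith
  · have h : ((j i : ℝ) + 1) ≤ 2 ^ k := by exact_mod_cast hj i
    have : s * ((j i : ℝ) + 1) / 2 ^ k ≤ s := by
      rw [div_le_iff₀ (by positivity)]
      gcongr
    linarith

lemma pairwise_disjoint_children (a : Fin n → ℝ) (s : ℝ) :
    Pairwise (Function.onFun Disjoint
      fun e : Fin n → Fin 2 => halfOpenCube (childCorner a s e) (s / 2)) := by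
  intro e e' hne
  refine Set.disjoint_left.2 fun x hx hx' => hne (funext fun i => ?_)
  have h := hx i trivial
  have h' := hx' i trivial
  simp only [childCorner, Set.mem_Ico] at h h'
  generalize e i = p at *
  generalize e' i = q at *
  fin_cases p <;> fin_cases q <;> simp at * <;> linarith

lemma iUnion_children (a : Fin n → ℝ) {s : ℝ} (hs : 0 < s) :
    ⋃ e : Fin n → Fin 2, halfOpenCube (childCorner a s e) (s / 2) = halfOpenCube a s := by
  ext x
  simp only [Set.mem_iUnion]
  constructor
  · rintro ⟨e, he⟩ i -
    have h := he i trivial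
    simp only [childCorner, Set.mem_Ico] at h ⊢
    generalize e i = p at *
    fin_cases p <;> simp at * <;> constructor <;> linarith
  · intro hx
    refine ⟨fun i => if x i < a i + s / 2 then 0 else 1, fun i _ => ?_⟩
    have h := hx i trivial
    simp only [childCorner, Set.mem_Ico] at h ⊢
    split_ifs with hlt <;> simp <;> constructor <;> linarith

lemma child_subset (a : Fin n → ℝ) {s : ℝ} (hs : 0 < s) (e : Fin n → Fin 2) :
    halfOpenCube (childCorner a s e) (s / 2) ⊆ halfOpenCube a s :=
  iUnion_children a hs ▸ Set.subset_iUnion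
    (fun e : Fin n → Fin 2 => halfOpenCube (childCorner a s e) (s / 2)) e

end Cubes

section TruncMax

variable {n : ℕ} (g : (Fin n → ℝ) → ℝ≥0∞)

lemma cubeAvg_mul_volume (a : Fin n → ℝ) {s : ℝ} (hs : 0 < s) :
    cubeAvg g a s * volume (halfOpenCube a s) = ∫⁻ y in halfOpenCube a s, g y :=
  ENNReal.div_mul_cancel (volume_halfOpenCube_ne_zero a hs) (volume_halfOpenCube_ne_top a s)

lemma measurable_truncMax (d : ℕ) (a : Fin n → ℝ) (s : ℝ) : Measurable (truncMax g d a s) := by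
  induction d generalizing a s with
  | zero => exact measurable_const
  | succ d ih =>
    exact measurable_const.max (Measurable.iSup fun e =>
      (ih _ _).indicator (measurableSet_halfOpenCube _ _))

lemma cubeAvg_le_truncMax (d : ℕ) (a : Fin n → ℝ) (s : ℝ) (x : Fin n → ℝ) :
    cubeAvg g a s ≤ truncMax g d a s x := by
  cases d with
  | zero => exact le_rfl
  | succ d => exact le_max_left _ _

lemma truncMax_child_le (d : ℕ) (a : Fin n → ℝ) (s : ℝ) {e : Fin n → Fin 2} {x : Fin n → ℝ}
    (hx : x ∈ halfOpenCube (childCorner a s e) (s / 2)) :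
    truncMax g d (childCorner a s e) (s / 2) x ≤ truncMax g (d + 1) a s x := by
  refine le_max_of_le_right (le_iSup_of_le e ?_)
  rw [Set.indicator_of_mem hx]

lemma truncMax_succ_of_mem (d : ℕ) (a : Fin n → ℝ) (s : ℝ) {e : Fin n → Fin 2}
    {x : Fin n → ℝ} (hx : x ∈ halfOpenCube (childCorner a s e) (s / 2)) :
    truncMax g (d + 1) a s x =
      max (cubeAvg g a s) (truncMax g d (childCorner a s e) (s / 2) x) := by
  refine le_antisymm (max_le_max le_rfl (iSup_le fun e' => ?_))
    (max_le (cubeAvg_le_truncMax g _ _ _ _) (truncMax_child_le g d a s hx))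
  by_cases he : e' = e
  · subst he
    exact Set.indicator_le_self _ _ _
  · rw [Set.indicator_of_notMem]
    · exact zero_le
    · exact fun hx' => Set.disjoint_left.1 (pairwise_disjoint_children a s he) hx' hx

lemma monotone_truncMax (a : Fin n → ℝ) (s : ℝ) :
    Monotone fun d => truncMax g d a s := by
  refine monotone_nat_of_le_succ fun d => ?_
  induction d generalizing a s with
  | zero => exact fun x => cubeAvg_le_truncMax g _ _ _ _
  | succ d ih =>
    exact fun x => max_le_max le_rfl (iSup_mono fun e => Set.indicator_le_indicator (ih _ _ x))

lemma truncMax_bounded (hg : ∀ a s, ∫⁻ y in halfOpenCube a s, g y ≠ ∞) (d : ℕ)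
    (a : Fin n → ℝ) {s : ℝ} (hs : 0 < s) :
    ∃ B : ℝ≥0∞, B ≠ ∞ ∧ ∀ x, truncMax g d a s x ≤ B := by
  have havg : ∀ a s, 0 < s → cubeAvg g a s ≠ ∞ := fun a s hs =>
    ENNReal.div_ne_top (hg a s) (volume_halfOpenCube_ne_zero a hs)
  induction d generalizing a s with
  | zero => exact ⟨_, havg a s hs, fun _ => le_rfl⟩
  | succ d ih =>
    choose B hB hle using fun e : Fin n → Fin 2 => ih (childCorner a s e) (half_pos hs)
    refine ⟨cubeAvg g a s + ∑ e, B e, ENNReal.add_ne_top.2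
      ⟨havg a s hs, ENNReal.sum_ne_top.2 fun e _ => hB e⟩, fun x => max_le le_self_add
        (iSup_le fun e => (Set.indicator_le_self _ _ _).trans ((hle e x).trans ?_))⟩
    exact (Finset.single_le_sum (f := B) (fun _ _ => zero_le) (Finset.mem_univ e)).trans
      le_add_self

/-- The tail estimate behind the reverse Hölder inequality: the factor `2 ^ n` comes from comparing
a dyadic cube with its parent. -/
lemma lintegral_truncMax_sub_le (hg : ∀ a s, ∫⁻ y in halfOpenCube a s, g y ≠ ∞) (D : ℝ≥0∞)
    (hFW : ∀ d a s, 0 < s → ∫⁻ x in halfOpenCube a s, truncMax g d a s x ≤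
      (1 + D) * ∫⁻ y in halfOpenCube a s, g y)
    (t : ℝ≥0∞) (d : ℕ) (a : Fin n → ℝ) {s : ℝ} (hs : 0 < s) (ht : cubeAvg g a s ≤ t) :
    ∫⁻ x in halfOpenCube a s, (truncMax g d a s x - t) ≤
      2 ^ n * D * t * volume (halfOpenCube a s ∩ {x | t < truncMax g d a s x}) := by
  induction d generalizing a s with
  | zero => simp [truncMax, tsub_eq_zero_of_le ht]
  | succ d ih =>
    by_cases hch : ∃ e : Fin n → Fin 2, t < cubeAvg g (childCorner a s e) (s / 2)
    · obtain ⟨e, he⟩ := hch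
      have hsub : halfOpenCube (childCorner a s e) (s / 2) ⊆
          halfOpenCube a s ∩ {x | t < truncMax g (d + 1) a s x} := fun x hx =>
        ⟨child_subset a hs e hx, he.trans_le
          ((cubeAvg_le_truncMax g d _ _ x).trans (truncMax_child_le g d a s hx))⟩
      calc ∫⁻ x in halfOpenCube a s, (truncMax g (d + 1) a s x - t)
          ≤ ∫⁻ x in halfOpenCube a s, (truncMax g (d + 1) a s x - cubeAvg g a s) :=
            lintegral_mono fun x => tsub_le_tsub_left ht _
        _ = (∫⁻ x in halfOpenCube a s, truncMax g (d + 1) a s x) -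
              ∫⁻ y in halfOpenCube a s, g y := by
            rw [lintegral_sub measurable_const _
              (Filter.Eventually.of_forall fun x => cubeAvg_le_truncMax g _ _ _ _)]
            · rw [setLIntegral_const, cubeAvg_mul_volume g a hs]
            · rw [setLIntegral_const, cubeAvg_mul_volume g a hs]
              exact hg a s
        _ ≤ D * ∫⁻ y in halfOpenCube a s, g y := by
            rw [tsub_le_iff_left]
            calc _ ≤ _ := hFW (d + 1) a s hs
              _ = _ := by ring
        _ = D * (cubeAvg g a s * volume (halfOpenCube a s)) := by
            rw [cubeAvg_mul_volume g a hs]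
        _ ≤ D * (t * (2 ^ n * volume (halfOpenCube (childCorner a s e) (s / 2)))) := by
            rw [← volume_halfOpenCube_eq_child a]
            gcongr
        _ = 2 ^ n * D * t * volume (halfOpenCube (childCorner a s e) (s / 2)) := by ring
        _ ≤ _ := by gcongr
    · push Not at hch
      have hmeas := fun e : Fin n → Fin 2 =>
        measurableSet_halfOpenCube (childCorner a s e) (s / 2)
      have hdisj := pairwise_disjoint_children a s
      rw [← iUnion_children a hs, lintegral_iUnion hmeas hdisj, Set.iUnion_inter,
        measure_iUnion (hdisj.mono fun i j h => h.mono Set.inter_subset_left Set.inter_subset_left)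
          fun e => (hmeas e).inter (measurableSet_lt measurable_const (measurable_truncMax g _ _ _)),
        tsum_fintype, tsum_fintype, Finset.mul_sum]
      refine Finset.sum_le_sum fun e _ => ?_
      have hset : halfOpenCube (childCorner a s e) (s / 2) ∩ {x | t < truncMax g (d + 1) a s x} =
          halfOpenCube (childCorner a s e) (s / 2) ∩
            {x | t < truncMax g d (childCorner a s e) (s / 2) x} := by
        ext x
        refine and_congr_right fun hx => ?_
        simp [truncMax_succ_of_mem g d a s hx, ht.not_gt]
      rw [hset]
      refine le_trans (le_of_eq (setLIntegral_congr_fun (hmeas e) fun x hx => ?_))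
        (ih _ (half_pos hs) (hch e))
      rw [truncMax_succ_of_mem g d a s hx]
      rcases le_total (cubeAvg g a s) (truncMax g d (childCorner a s e) (s / 2) x) with h | h
      · rw [max_eq_right h]
      · rw [max_eq_left h, tsub_eq_zero_of_le ht, tsub_eq_zero_of_le (h.trans ht)]

end TruncMax

section Mdyadic

variable {n : ℕ}

lemma Mdyadic_child_le (f : (Fin n → ℝ) → ℝ) (a : Fin n → ℝ) (s : ℝ) (e : Fin n → Fin 2)
    (x : Fin n → ℝ) : Mdyadic (childCorner a s e) (s / 2) f x ≤ Mdyadic a s f x := by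
  refine iSup_le fun k => iSup_le fun j => iSup_le fun hj => iSup_le fun hx => ?_
  rw [dyadicCube_child] at hx ⊢
  have hj' : ∀ i, 2 ^ k * (e i : ℕ) + j i < 2 ^ (k + 1) := fun i => by
    have h1 := hj i
    have h2 : (e i : ℕ) ≤ 1 := by omega
    calc 2 ^ k * (e i : ℕ) + j i < 2 ^ k * 1 + 2 ^ k :=
          add_lt_add_of_le_of_lt (Nat.mul_le_mul_left _ h2) h1
      _ = 2 ^ (k + 1) := by ring
  exact le_iSup_of_le (k + 1) (le_iSup_of_le _ (le_iSup_of_le hj' (le_iSup_of_le hx le_rfl)))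

lemma truncMax_le_Mdyadic (f : (Fin n → ℝ) → ℝ) (d : ℕ) (a : Fin n → ℝ) (s : ℝ) {x : Fin n → ℝ}
    (hx : x ∈ halfOpenCube a s) :
    truncMax (fun y => ENNReal.ofReal |f y|) d a s x ≤ Mdyadic a s f x := by
  have havg : ∀ a s, x ∈ halfOpenCube a s →
      cubeAvg (fun y => ENNReal.ofReal |f y|) a s ≤ Mdyadic a s f x := fun a s hx => by
    refine le_iSup_of_le 0 (le_iSup_of_le (fun _ => 0) (le_iSup_of_le (fun _ => by simp) ?_))
    rw [dyadicCube_zero_zero]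
    exact le_iSup_of_le hx le_rfl
  induction d generalizing a s with
  | zero => exact havg a s hx
  | succ d ih =>
    refine max_le (havg a s hx) (iSup_le fun e => ?_)
    by_cases he : x ∈ halfOpenCube (childCorner a s e) (s / 2)
    · rw [Set.indicator_of_mem he]
      exact (ih _ _ he).trans (Mdyadic_child_le f a s e x)
    · rw [Set.indicator_of_notMem he]
      exact zero_le

lemma dyadic_average_le_truncMax (g : (Fin n → ℝ) → ℝ≥0∞) (k : ℕ) (j : Fin n → ℕ)
    (hj : ∀ i, j i < 2 ^ k) (a : Fin n → ℝ) {s : ℝ} (hs : 0 < s) {x : Fin n → ℝ}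
    (hx : x ∈ dyadicCube a s k j) :
    (∫⁻ y in dyadicCube a s k j, g y) / volume (dyadicCube a s k j) ≤ truncMax g k a s x := by
  induction k generalizing a s j with
  | zero =>
    have : j = fun _ => 0 := funext fun i => by simpa using hj i
    rw [this, dyadicCube_zero_zero]
    exact le_rfl
  | succ k ih =>
    have hdiv : ∀ i, j i / 2 ^ k < 2 := fun i =>
      Nat.div_lt_of_lt_mul ((hj i).trans_eq (pow_succ 2 k))
    have hmod : ∀ i, j i % 2 ^ k < 2 ^ k := fun i => Nat.mod_lt _ (by positivity)
    have heq := dyadicCube_child a s (fun i => ⟨j i / 2 ^ k, hdiv i⟩) k (fun i => j i % 2 ^ k)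
    simp only [Nat.div_add_mod] at heq
    rw [← heq] at hx ⊢
    exact (ih _ hmod _ (half_pos hs) hx).trans
      (truncMax_child_le g k a s (dyadicCube_subset _ (half_pos hs) k hmod hx))

lemma Mdyadic_eq_iSup_truncMax (f : (Fin n → ℝ) → ℝ) (a : Fin n → ℝ) {s : ℝ} (hs : 0 < s)
    {x : Fin n → ℝ} (hx : x ∈ halfOpenCube a s) :
    Mdyadic a s f x = ⨆ d, truncMax (fun y => ENNReal.ofReal |f y|) d a s x :=
  le_antisymm
    (iSup_le fun k => iSup_le fun j => iSup_le fun hj => iSup_le fun hxj =>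
      (dyadic_average_le_truncMax _ k j hj a hs hxj).trans
        (le_iSup (fun d => truncMax (fun y => ENNReal.ofReal |f y|) d a s x) k))
    (iSup_le fun d => truncMax_le_Mdyadic f d a s hx)

lemma Mdyadic_indicator (f : (Fin n → ℝ) → ℝ) (a : Fin n → ℝ) {s : ℝ} (hs : 0 < s)
    (x : Fin n → ℝ) : Mdyadic a s ((cube a s).indicator f) x = Mdyadic a s f x := by
  refine iSup_congr fun k => iSup_congr fun j => iSup_congr fun hj => iSup_congr fun _ => ?_
  congr 1
  refine lintegral_congr_ae ?_
  filter_upwards [ae_restrict_of_ae (cube_ae_eq_halfOpenCube a s).mem_iff,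
    ae_restrict_mem (by rw [dyadicCube_eq_halfOpenCube]; exact measurableSet_halfOpenCube _ _)]
    with y hy hyj
  rw [Set.indicator_of_mem (hy.2 (dyadicCube_subset a hs k hj hyj))]

lemma Mdyadic_le_maximal_ae (f : (Fin n → ℝ) → ℝ) (a : Fin n → ℝ) {s : ℝ} (hs : 0 < s) :
    ∀ᵐ x, Mdyadic a s f x ≤ maximal f x := by
  have hae : ∀ᵐ x, ∀ (k : ℕ) (j : Fin n → ℕ),
      x ∈ cube (fun i => a i + s * (j i : ℝ) / 2 ^ k) (s / 2 ^ k) ↔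
        x ∈ halfOpenCube (fun i => a i + s * (j i : ℝ) / 2 ^ k) (s / 2 ^ k) :=
    ae_all_iff.2 fun k => ae_all_iff.2 fun j => (cube_ae_eq_halfOpenCube _ _).mem_iff
  filter_upwards [hae] with x hx
  refine iSup_le fun k => iSup_le fun j => iSup_le fun _ => iSup_le fun hxj => ?_
  rw [dyadicCube_eq_halfOpenCube] at hxj ⊢
  rw [← setLIntegral_congr (cube_ae_eq_halfOpenCube _ _),
    ← measure_congr (cube_ae_eq_halfOpenCube _ _)]
  exact le_iSup_of_le (cube _ _) (le_iSup_of_le ⟨_, _, by positivity, rfl⟩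
    (le_iSup_of_le ((hx k j).2 hxj) le_rfl))

lemma lintegral_truncMax_le_of_maximal (w : (Fin n → ℝ) → ℝ) (C : ℝ≥0∞)
    (hFW : ∀ Q : Set (Fin n → ℝ), IsCube Q →
      ∫⁻ x in Q, maximal (Q.indicator w) x ≤ C * ∫⁻ x in Q, ENNReal.ofReal |w x|)
    (d : ℕ) (a : Fin n → ℝ) {s : ℝ} (hs : 0 < s) :
    ∫⁻ x in halfOpenCube a s, truncMax (fun y => ENNReal.ofReal |w y|) d a s x ≤
      C * ∫⁻ y in halfOpenCube a s, ENNReal.ofReal |w y| := by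
  calc ∫⁻ x in halfOpenCube a s, truncMax (fun y => ENNReal.ofReal |w y|) d a s x
      ≤ ∫⁻ x in halfOpenCube a s, maximal ((cube a s).indicator w) x := by
        refine lintegral_mono_ae ?_
        filter_upwards [ae_restrict_of_ae (Mdyadic_le_maximal_ae ((cube a s).indicator w) a hs),
          ae_restrict_mem (measurableSet_halfOpenCube a s)] with x hx hxQ
        rw [Mdyadic_indicator w a hs] at hx
        exact (truncMax_le_Mdyadic w d a s hxQ).trans hx
    _ = ∫⁻ x in cube a s, maximal ((cube a s).indicator w) x :=
        (setLIntegral_congr (cube_ae_eq_halfOpenCube a s)).symm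
    _ ≤ C * ∫⁻ x in cube a s, ENNReal.ofReal |w x| := hFW _ ⟨a, s, hs, rfl⟩
    _ = _ := by rw [setLIntegral_congr (cube_ae_eq_halfOpenCube a s)]

end Mdyadic

/-- A weighted form of Young's inequality. -/
lemma mul_rpow_sub_one_le {δ w m r : ℝ} (hδ : 0 < δ) (hw : 0 < w) (hm : 0 ≤ m) (hr : 1 ≤ r) :
    r * w ^ (r - 1) * m ≤ δ ^ (1 - r) * m ^ r + (r - 1) * δ * w ^ r := by
  have hδw : 0 < δ * w := mul_pos hδ hw
  have h := one_add_mul_self_le_rpow_one_add (s := m / (δ * w) - 1)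
    (by have : 0 ≤ m / (δ * w) := by positivity
        linarith) hr
  rw [add_sub_cancel, Real.div_rpow hm hδw.le, Real.mul_rpow hδ.le hw.le] at h
  have hδr := Real.rpow_pos_of_pos hδ r
  have hwr := Real.rpow_pos_of_pos hw r
  have h2 := mul_le_mul_of_nonneg_left h (mul_pos hδ hwr).le
  have e1 : δ * w ^ r * (m ^ r / (δ ^ r * w ^ r)) = δ ^ (1 - r) * m ^ r := by
    rw [Real.rpow_sub hδ, Real.rpow_one]
    field_simp
  have e2 : δ * w ^ r * (1 + r * (m / (δ * w) - 1)) =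
      r * w ^ (r - 1) * m - (r - 1) * δ * w ^ r := by
    rw [Real.rpow_sub hw, Real.rpow_one]
    field_simp
    ring
  rw [e1, e2] at h2
  linarith

section TailEstimate

lemma setLIntegral_Ioi_rpow_mul_sub {w x r : ℝ} (hw : 0 < w) (hr : 1 ≤ r) (hx : w ≤ x) :
    ∫⁻ t in Set.Ioi w, ENNReal.ofReal (r * (r - 1) * t ^ (r - 2) * (x - t)) =
      ENNReal.ofReal (x ^ r - w ^ r - r * w ^ (r - 1) * (x - w)) := by
  have hnonneg : ∀ t ∈ Set.Ioc w x, 0 ≤ r * (r - 1) * t ^ (r - 2) * (x - t) := fun t ht => by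
    have h1 : 0 < t := hw.trans ht.1
    have h2 : 0 ≤ x - t := sub_nonneg.2 ht.2
    have h3 : 0 ≤ r - 1 := sub_nonneg.2 hr
    positivity
  have hcont : ContinuousOn (fun t : ℝ => r * (r - 1) * t ^ (r - 2) * (x - t)) (Set.uIcc w x) := by
    rw [Set.uIcc_of_le hx]
    refine (continuousOn_const.mul (continuousOn_id.rpow_const fun t ht => Or.inl
      (hw.trans_le ht.1).ne')).mul (by fun_prop)
  have hint := hcont.intervalIntegrable (μ := volume)
  have hftc : ∫ t in w..x, r * (r - 1) * t ^ (r - 2) * (x - t) =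
      x ^ r - w ^ r - r * w ^ (r - 1) * (x - w) := by
    rw [intervalIntegral.integral_eq_sub_of_hasDerivAt
      (f := fun t => r * t ^ (r - 1) * (x - t) + t ^ r) (fun t ht => ?_) hint]
    · ring
    · rw [Set.uIcc_of_le hx] at ht
      have ht0 : t ≠ 0 := (hw.trans_le ht.1).ne'
      have h1 := ((Real.hasDerivAt_rpow_const (p := r - 1) (Or.inl ht0)).const_mul r).mul
        ((hasDerivAt_id t).const_sub x)
      have h2 := h1.add (Real.hasDerivAt_rpow_const (p := r) (Or.inl ht0))
      refine HasDerivAt.congr_deriv h2 ?_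
      rw [show r - 1 - 1 = r - 2 by ring, id]
      ring
  have hsplit : ∫⁻ t in Set.Ioi w, ENNReal.ofReal (r * (r - 1) * t ^ (r - 2) * (x - t)) =
      ∫⁻ t in Set.Ioc w x, ENNReal.ofReal (r * (r - 1) * t ^ (r - 2) * (x - t)) := by
    rw [← Set.Ioc_union_Ioi_eq_Ioi hx, lintegral_union measurableSet_Ioi
      (Set.disjoint_left.2 fun t h1 h2 => (not_lt.2 h1.2) h2)]
    rw [setLIntegral_congr_fun (g := fun _ => 0) (s := Set.Ioi x) measurableSet_Ioi fun t ht => ?_]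
    · simp
    · have h1 : 0 < t := hw.trans (hx.trans_lt ht)
      have h2 : x - t ≤ 0 := sub_nonpos.2 (le_of_lt ht)
      have h3 : 0 ≤ r - 1 := sub_nonneg.2 hr
      exact ENNReal.ofReal_of_nonpos (mul_nonpos_of_nonneg_of_nonpos (by positivity) h2)
  rw [hsplit, ← hftc, intervalIntegral.integral_of_le hx, ofReal_integral_eq_lintegral_ofReal]
  · exact (intervalIntegrable_iff_integrableOn_Ioc_of_le hx).1 hint
  · exact (ae_restrict_iff' measurableSet_Ioc).2 (Filter.Eventually.of_forall hnonneg)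

lemma setLIntegral_Ioi_rpow_indicator {w x r : ℝ} (hw : 0 < w) (hr : 1 ≤ r) (hx : w ≤ x) :
    ∫⁻ t in Set.Ioi w, (Set.Iio x).indicator (fun t => ENNReal.ofReal (r * t ^ (r - 1))) t =
      ENNReal.ofReal (x ^ r - w ^ r) := by
  have hcont : ContinuousOn (fun t : ℝ => r * t ^ (r - 1)) (Set.uIcc w x) := by
    rw [Set.uIcc_of_le hx]
    exact continuousOn_const.mul (continuousOn_id.rpow_const fun t ht => Or.inl
      (hw.trans_le ht.1).ne')
  have hint := hcont.intervalIntegrable (μ := volume)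
  have hftc : ∫ t in w..x, r * t ^ (r - 1) = x ^ r - w ^ r := by
    refine intervalIntegral.integral_eq_sub_of_hasDerivAt (f := fun t => t ^ r)
      (fun t ht => ?_) hint
    rw [Set.uIcc_of_le hx] at ht
    exact Real.hasDerivAt_rpow_const (Or.inl (hw.trans_le ht.1).ne')
  rw [lintegral_indicator measurableSet_Iio, Measure.restrict_restrict measurableSet_Iio,
    Set.inter_comm, Set.Ioi_inter_Iio, setLIntegral_congr Ioo_ae_eq_Ioc, ← hftc,
    intervalIntegral.integral_of_le hx, ofReal_integral_eq_lintegral_ofReal]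
  · exact (intervalIntegrable_iff_integrableOn_Ioc_of_le hx).1 hint
  · refine (ae_restrict_iff' measurableSet_Ioc).2 (Filter.Eventually.of_forall fun t ht => ?_)
    have h1 : 0 < t := hw.trans ht.1
    have h2 : 0 < r := by linarith
    show 0 ≤ r * t ^ (r - 1)
    positivity

variable {α : Type*} [MeasurableSpace α] {μ : Measure α}

/-- Integrating the tail estimate `∫ (G - t)⁺ ≤ c t μ {G > t}` against `t ^ (r - 2)`. -/
lemma lintegral_rpow_sub_le_of_tail [SFinite μ] {G : α → ℝ} (hG : Measurable G) {w c r : ℝ}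
    (hw : 0 < w) (hwG : ∀ x, w ≤ G x) (hc : 0 ≤ c) (hr : 1 ≤ r)
    (htail : ∀ t, w ≤ t →
      ∫⁻ x, ENNReal.ofReal (G x - t) ∂μ ≤ ENNReal.ofReal (c * t) * μ {x | t < G x}) :
    ∫⁻ x, ENNReal.ofReal (G x ^ r - w ^ r - r * w ^ (r - 1) * (G x - w)) ∂μ ≤
      ENNReal.ofReal (c * (r - 1)) * ∫⁻ x, ENNReal.ofReal (G x ^ r - w ^ r) ∂μ := by
  have hr1 : 0 ≤ r - 1 := sub_nonneg.2 hr
  have hpow : Measurable fun p : α × ℝ => p.2 ^ (r - 2) := by fun_prop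
  have hmeas : Measurable (Function.uncurry fun (t : ℝ) (x : α) =>
      (Set.Iio (G x)).indicator (fun t => ENNReal.ofReal (r * t ^ (r - 1))) t) := by
    have : (Function.uncurry fun (t : ℝ) (x : α) =>
        (Set.Iio (G x)).indicator (fun t => ENNReal.ofReal (r * t ^ (r - 1))) t) =
        {p : ℝ × α | p.1 < G p.2}.indicator fun p => ENNReal.ofReal (r * p.1 ^ (r - 1)) := by
      ext ⟨t, x⟩
      simp [Set.indicator]
    rw [this]
    exact Measurable.indicator (by fun_prop)
      (measurableSet_lt measurable_fst (hG.comp measurable_snd))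
  calc ∫⁻ x, ENNReal.ofReal (G x ^ r - w ^ r - r * w ^ (r - 1) * (G x - w)) ∂μ
      = ∫⁻ x, (∫⁻ t in Set.Ioi w, ENNReal.ofReal (r * (r - 1) * t ^ (r - 2) * (G x - t))) ∂μ :=
        lintegral_congr fun x => (setLIntegral_Ioi_rpow_mul_sub hw hr (hwG x)).symm
    _ = ∫⁻ t in Set.Ioi w, ∫⁻ x, ENNReal.ofReal (r * (r - 1) * t ^ (r - 2) * (G x - t)) ∂μ := by
        refine lintegral_lintegral_swap (Measurable.aemeasurable ?_)
        exact (((hpow.const_mul (r * (r - 1)))).mul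
          ((hG.comp measurable_fst).sub measurable_snd)).ennreal_ofReal
    _ ≤ ∫⁻ t in Set.Ioi w, ENNReal.ofReal (c * (r - 1)) *
          ∫⁻ x, (Set.Iio (G x)).indicator (fun t => ENNReal.ofReal (r * t ^ (r - 1))) t ∂μ := by
        refine setLIntegral_mono' measurableSet_Ioi fun t ht => ?_
        have ht0 : 0 < t := hw.trans ht
        have hcoef : 0 ≤ r * (r - 1) * t ^ (r - 2) := by positivity
        have hind : ∀ x, (Set.Iio (G x)).indicator
            (fun t => ENNReal.ofReal (r * t ^ (r - 1))) t =
            {x | t < G x}.indicator (fun _ => ENNReal.ofReal (r * t ^ (r - 1))) x := fun x => by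
          simp [Set.indicator]
        simp only [hind, ENNReal.ofReal_mul hcoef]
        rw [lintegral_const_mul _ (hG.sub_const t).ennreal_ofReal,
          lintegral_indicator_const (measurableSet_lt measurable_const hG), ← mul_assoc,
          ← ENNReal.ofReal_mul (by positivity)]
        calc ENNReal.ofReal (r * (r - 1) * t ^ (r - 2)) * ∫⁻ x, ENNReal.ofReal (G x - t) ∂μ
            ≤ ENNReal.ofReal (r * (r - 1) * t ^ (r - 2)) *
                (ENNReal.ofReal (c * t) * μ {x | t < G x}) := by
              gcongr
              exact htail t (le_of_lt ht)
          _ = _ := by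
              rw [← mul_assoc, ← ENNReal.ofReal_mul hcoef]
              congr 2
              rw [show r - 1 = r - 2 + 1 by ring, Real.rpow_add_one ht0.ne']
              ring
    _ = _ := by
        rw [lintegral_const_mul' _ _ ENNReal.ofReal_ne_top, lintegral_lintegral_swap
          hmeas.aemeasurable]
        congr 1
        exact lintegral_congr fun x => setLIntegral_Ioi_rpow_indicator hw hr (hwG x)

lemma integral_rpow_le_of_tail [IsFiniteMeasure μ] {G : α → ℝ} (hG : Measurable G) {w B c r : ℝ}
    (hw : 0 < w) (hwG : ∀ x, w ≤ G x) (hB : ∀ x, G x ≤ B) (hc : 0 ≤ c) (hr : 1 ≤ r)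
    (htail : ∀ t, w ≤ t →
      ∫⁻ x, ENNReal.ofReal (G x - t) ∂μ ≤ ENNReal.ofReal (c * t) * μ {x | t < G x}) :
    (1 - c * (r - 1)) * ∫ x, G x ^ r ∂μ ≤ (1 - c * (r - 1)) * (w ^ r * μ.real Set.univ) +
      r * w ^ (r - 1) * (∫ x, G x ∂μ - w * μ.real Set.univ) := by
  have h0 : ∀ x, 0 ≤ G x := fun x => hw.le.trans (hwG x)
  have hr1 : 0 ≤ r - 1 := sub_nonneg.2 hr
  have hGi : Integrable G μ := Integrable.of_bound hG.aestronglyMeasurable B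
    (Filter.Eventually.of_forall fun x => by rw [Real.norm_of_nonneg (h0 x)]; exact hB x)
  have hGr : Integrable (fun x => G x ^ r) μ :=
    Integrable.of_bound (hG.pow_const r).aestronglyMeasurable (B ^ r)
      (Filter.Eventually.of_forall fun x => by
        rw [Real.norm_of_nonneg (Real.rpow_nonneg (h0 x) r)]
        exact Real.rpow_le_rpow (h0 x) (hB x) (by linarith))
  have hmono : ∀ x, w ^ r ≤ G x ^ r := fun x => Real.rpow_le_rpow hw.le (hwG x) (by linarith)
  have hi1 : Integrable (fun x => G x ^ r - w ^ r) μ := hGr.sub (integrable_const _)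
  have hi2 : Integrable (fun x => r * w ^ (r - 1) * (G x - w)) μ :=
    (hGi.sub (integrable_const _)).const_mul _
  have hle := lintegral_rpow_sub_le_of_tail hG hw hwG hc hr htail
  rw [← ofReal_integral_eq_lintegral_ofReal hi1
    (Filter.Eventually.of_forall fun x => sub_nonneg.2 (hmono x)),
    ← ENNReal.ofReal_mul (by positivity)] at hle
  have hle' : ∫ x, (G x ^ r - w ^ r - r * w ^ (r - 1) * (G x - w)) ∂μ ≤
      c * (r - 1) * ∫ x, (G x ^ r - w ^ r) ∂μ := by
    refine (ENNReal.ofReal_le_ofReal_iff (mul_nonneg (by positivity)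
      (integral_nonneg fun x => sub_nonneg.2 (hmono x)))).1 (le_trans ?_ hle)
    refine (ofReal_integral_eq_lintegral_ofReal (hi1.sub hi2)
      (Filter.Eventually.of_forall fun x => ?_)).le
    have hy := mul_rpow_sub_one_le one_pos hw (h0 x) hr
    have hww : w ^ r = w ^ (r - 1) * w := by
      rw [← Real.rpow_add_one hw.ne', sub_add_cancel]
    rw [Real.one_rpow] at hy
    show 0 ≤ G x ^ r - w ^ r - r * w ^ (r - 1) * (G x - w)
    rw [hww] at hy ⊢
    linarith
  rw [integral_sub hi1 hi2, integral_const_mul, integral_sub hGi (integrable_const _),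
    integral_sub hGr (integrable_const _), integral_const, integral_const, smul_eq_mul,
    smul_eq_mul] at hle'
  linarith

end TailEstimate

lemma lintegral_truncMax_rpow_le {n : ℕ} {g : (Fin n → ℝ) → ℝ≥0∞}
    (hg : ∀ a s, ∫⁻ y in halfOpenCube a s, g y ≠ ∞) {δ : ℝ} (hδ : 1 < δ)
    (hFW : ∀ d a s, 0 < s → ∫⁻ x in halfOpenCube a s, truncMax g d a s x ≤
      ENNReal.ofReal δ * ∫⁻ y in halfOpenCube a s, g y)
    {r : ℝ} (hr : 1 ≤ r) (hκ : 2 ^ n * (δ - 1) * (r - 1) < 1)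
    (d : ℕ) (a : Fin n → ℝ) {s : ℝ} (hs : 0 < s) :
    (∫⁻ x in halfOpenCube a s, truncMax g d a s x ^ r) / volume (halfOpenCube a s) ≤
      ENNReal.ofReal (δ ^ (1 - r) * (1 / (1 - 2 ^ n * (δ - 1) * (r - 1)))) *
        ((∫⁻ x in halfOpenCube a s, truncMax g d a s x) / volume (halfOpenCube a s)) ^ r := by
  have hr0 : 0 < r := by linarith
  have hδ0 : 0 < δ := by linarith
  have hδ1 : 0 ≤ δ - 1 := by linarith
  have htail := fun t => lintegral_truncMax_sub_le g hg (ENNReal.ofReal (δ - 1)) (fun d a s hs => by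
    rw [← ENNReal.ofReal_one, ← ENNReal.ofReal_add zero_le_one hδ1, add_sub_cancel]
    exact hFW d a s hs) t d a hs
  have hmeas := measurable_truncMax g d a s
  rcases eq_or_ne (cubeAvg g a s) 0 with h0 | h0
  · have hz := htail 0 h0.le
    simp only [tsub_zero, mul_zero, zero_mul, nonpos_iff_eq_zero] at hz
    rw [lintegral_eq_zero_iff hmeas] at hz
    have hz' : ∫⁻ x in halfOpenCube a s, truncMax g d a s x ^ r = 0 := by
      rw [lintegral_eq_zero_iff (hmeas.pow_const r)]
      filter_upwards [hz] with x hx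
      simp [hx, hr0]
    simp [hz']
  obtain ⟨B, hB, hle⟩ := truncMax_bounded g hg d a hs
  set μ := volume.restrict (halfOpenCube a s) with hμ
  have hμuniv : μ Set.univ = volume (halfOpenCube a s) := by simp [hμ]
  have : IsFiniteMeasure μ :=
    ⟨by rw [hμuniv]; exact (volume_halfOpenCube_ne_top a s).lt_top⟩
  have hfin : ∀ x, truncMax g d a s x ≠ ∞ := fun x => ne_top_of_le_ne_top hB (hle x)
  have havg : cubeAvg g a s ≠ ∞ :=
    ne_top_of_le_ne_top (hfin a) (cubeAvg_le_truncMax g d a s a)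
  set w := (cubeAvg g a s).toReal with hw
  have hwpos : 0 < w := ENNReal.toReal_pos h0 havg
  set G := fun x => (truncMax g d a s x).toReal with hG
  have key := integral_rpow_le_of_tail (μ := μ) (G := G) hmeas.ennreal_toReal hwpos
    (fun x => ENNReal.toReal_mono (hfin x) (cubeAvg_le_truncMax g d a s x))
    (fun x => ENNReal.toReal_mono hB (hle x)) (c := 2 ^ n * (δ - 1)) (by positivity) hr
    (fun t ht => by
      have ht0 : 0 ≤ t := hwpos.le.trans ht
      have h1 := htail (ENNReal.ofReal t) ((ENNReal.le_ofReal_iff_toReal_le havg ht0).2 ht)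
      have hset : {x | t < G x} = {x | ENNReal.ofReal t < truncMax g d a s x} := by
        ext x
        exact (ENNReal.ofReal_lt_iff_lt_toReal ht0 (hfin x)).symm
      have hsub : ∀ x, ENNReal.ofReal (G x - t) = truncMax g d a s x - ENNReal.ofReal t :=
        fun x => by rw [ENNReal.ofReal_sub _ ht0, ENNReal.ofReal_toReal (hfin x)]
      have hconst : ENNReal.ofReal (2 ^ n * (δ - 1) * t) =
          2 ^ n * ENNReal.ofReal (δ - 1) * ENNReal.ofReal t := by
        rw [ENNReal.ofReal_mul (by positivity), ENNReal.ofReal_mul (by positivity),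
          ENNReal.ofReal_pow (by norm_num), ENNReal.ofReal_ofNat]
      simp only [hsub, hset, hconst]
      rwa [hμ, Measure.restrict_apply (measurableSet_lt measurable_const hmeas), Set.inter_comm])
  have hV : 0 < μ.real Set.univ := by
    rw [Measure.real, hμuniv]
    exact ENNReal.toReal_pos (volume_halfOpenCube_ne_zero a hs) (volume_halfOpenCube_ne_top a s)
  have hI : ∫⁻ x, truncMax g d a s x ∂μ = ENNReal.ofReal (∫ x, G x ∂μ) := by
    rw [integral_toReal hmeas.aemeasurable
      (Filter.Eventually.of_forall fun x => (hfin x).lt_top), ENNReal.ofReal_toReal]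
    refine ne_top_of_le_ne_top ?_ (lintegral_mono hle)
    rw [lintegral_const]
    exact ENNReal.mul_ne_top hB (measure_ne_top _ _)
  have hIr : ∫⁻ x, truncMax g d a s x ^ r ∂μ = ENNReal.ofReal (∫ x, G x ^ r ∂μ) := by
    simp only [hG, ENNReal.toReal_rpow]
    rw [integral_toReal (hmeas.pow_const r).aemeasurable (Filter.Eventually.of_forall fun x =>
      (ENNReal.rpow_ne_top_of_nonneg hr0.le (hfin x)).lt_top), ENNReal.ofReal_toReal]
    refine ne_top_of_le_ne_top ?_
      (lintegral_mono fun x => ENNReal.rpow_le_rpow (hle x) hr0.le)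
    rw [lintegral_const]
    exact ENNReal.mul_ne_top (ENNReal.rpow_ne_top_of_nonneg hr0.le hB) (measure_ne_top _ _)
  have hm : 0 ≤ ∫ x, G x ∂μ := integral_nonneg fun x => ENNReal.toReal_nonneg
  rw [hI, hIr, ← hμuniv, ← ENNReal.ofReal_toReal (measure_ne_top μ Set.univ), ← Measure.real,
    ← ENNReal.ofReal_div_of_pos hV, ← ENNReal.ofReal_div_of_pos hV,
    ENNReal.ofReal_rpow_of_nonneg (by positivity) hr0.le,
    ← ENNReal.ofReal_mul (mul_nonneg (Real.rpow_nonneg hδ0.le _)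
      (one_div_nonneg.2 (sub_nonneg.2 hκ.le)))]
  refine ENNReal.ofReal_le_ofReal ?_
  generalize ∫ x, G x ∂μ = m at *
  generalize ∫ x, G x ^ r ∂μ = X at *
  generalize μ.real Set.univ = V at *
  have hy := mul_rpow_sub_one_le hδ0 hwpos (show 0 ≤ m / V by positivity) hr
  have hww : w ^ (r - 1) * w = w ^ r := by
    rw [← Real.rpow_add_one hwpos.ne', sub_add_cancel]
  have hpow : (1 : ℝ) ≤ 2 ^ n := one_le_pow₀ (by norm_num)
  have hκ' : (δ - 1) * (r - 1) ≤ 2 ^ n * (δ - 1) * (r - 1) := by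
    have h1 : 0 ≤ (δ - 1) * (r - 1) := mul_nonneg hδ1 (by linarith)
    nlinarith
  have hκ1 : 0 < 1 - 2 ^ n * (δ - 1) * (r - 1) := sub_pos.2 hκ
  generalize 2 ^ n * (δ - 1) * (r - 1) = κ at *
  rw [show δ ^ (1 - r) * (1 / (1 - κ)) * (m / V) ^ r = δ ^ (1 - r) * (m / V) ^ r / (1 - κ) by ring,
    le_div_iff₀ hκ1]
  have hkey : X / V * (1 - κ) ≤ (1 - κ) * w ^ r + r * w ^ (r - 1) * (m / V) - r * w ^ r := by
    rw [← hww, div_mul_eq_mul_div, div_le_iff₀ hV]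
    calc X * (1 - κ) = (1 - κ) * X := mul_comm _ _
      _ ≤ _ := key
      _ = _ := by
        rw [← hww]
        field_simp
        ring
  have hwr := mul_le_mul_of_nonneg_right hκ' (Real.rpow_nonneg hwpos.le r)
  linarith

lemma lintegral_halfOpenCube_ne_top {n : ℕ} {w : (Fin n → ℝ) → ℝ}
    (hloc : LocallyIntegrable w volume) (a : Fin n → ℝ) (s : ℝ) :
    ∫⁻ y in halfOpenCube a s, ENNReal.ofReal |w y| ≠ ∞ := by
  have hint : IntegrableOn w (Set.Icc a fun i => a i + s) :=
    hloc.integrableOn_isCompact isCompact_Icc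
  have hsub : halfOpenCube a s ⊆ Set.Icc a fun i => a i + s := fun x hx =>
    ⟨fun i => (hx i trivial).1, fun i => (hx i trivial).2.le⟩
  simpa [Real.enorm_eq_ofReal_abs] using (hint.mono_set hsub).hasFiniteIntegral.ne

/-- Asymptotically sharp reverse Hölder inequality for the local dyadic maximal
function of an `A∞` weight in `ℝⁿ` with Fujii–Wilson constant at most `δ`.
The constant `δ^{1-r}(r'-1)/(r'-1-2ⁿ(δ-1))` is written in the equivalent form
`δ^{1-r}/(1-2ⁿ(δ-1)(r-1))`, valid also at `r = 1`. -/
theorem stmt19 {n : ℕ} (w : (Fin n → ℝ) → ℝ) (hw : ∀ x, 0 ≤ w x)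
    (hloc : LocallyIntegrable w volume) (δ : ℝ) (hδ : 1 < δ)
    (hFW : ∀ Q' : Set (Fin n → ℝ), IsCube Q' →
      (∫⁻ x in Q', maximal (Q'.indicator w) x) ≤
        ENNReal.ofReal δ * ∫⁻ x in Q', ENNReal.ofReal (w x))
    (a : Fin n → ℝ) (s : ℝ) (hs : 0 < s) (r : ℝ) (hr1 : 1 ≤ r)
    (hr2 : r < 1 + 1 / (2 ^ n * (δ - 1))) :
    (∫⁻ x in cube a s, (Mdyadic a s ((cube a s).indicator w) x) ^ r) /
        volume (cube a s) ≤
      ENNReal.ofReal (δ ^ (1 - r) * (1 / (1 - 2 ^ n * (δ - 1) * (r - 1)))) *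
        ((∫⁻ x in cube a s, Mdyadic a s ((cube a s).indicator w) x) /
            volume (cube a s)) ^ r := by
  have hr0 : 0 < r := by linarith
  have hκ : 2 ^ n * (δ - 1) * (r - 1) < 1 := by
    have h1 : 0 < 2 ^ n * (δ - 1) := mul_pos (by positivity) (by linarith)
    have h2 := (lt_div_iff₀ h1).1 (sub_left_lt_of_lt_add hr2)
    linarith
  set g : (Fin n → ℝ) → ℝ≥0∞ := fun y => ENNReal.ofReal |w y| with hg
  have hbound := lintegral_truncMax_rpow_le (g := g) (lintegral_halfOpenCube_ne_top hloc) hδ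
    (fun d a s hs => lintegral_truncMax_le_of_maximal w _ (by simpa [abs_of_nonneg, hw] using hFW)
      d a hs) hr1 hκ
  have hM : ∀ x ∈ halfOpenCube a s, Mdyadic a s ((cube a s).indicator w) x =
      ⨆ d, truncMax g d a s x := fun x hx => by
    rw [Mdyadic_indicator w a hs, Mdyadic_eq_iSup_truncMax w a hs hx]
  have hQ := measurableSet_halfOpenCube a s
  have hV0 := volume_halfOpenCube_ne_zero a hs
  have hVt := volume_halfOpenCube_ne_top a s
  rw [setLIntegral_congr (cube_ae_eq_halfOpenCube a s),
    setLIntegral_congr (cube_ae_eq_halfOpenCube a s), measure_congr (cube_ae_eq_halfOpenCube a s),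
    setLIntegral_congr_fun hQ hM,
    setLIntegral_congr_fun (g := fun x => ⨆ d, truncMax g d a s x ^ r) hQ fun x hx => by
      rw [hM x hx]
      exact (ENNReal.orderIsoRpow r hr0).map_iSup _,
    lintegral_iSup (fun d => (measurable_truncMax g d a s).pow_const r)
      (fun d d' h x => ENNReal.rpow_le_rpow (monotone_truncMax g a s h x) hr0.le),
    ENNReal.div_le_iff hV0 hVt]
  refine iSup_le fun d => (ENNReal.div_le_iff hV0 hVt).1 ((hbound d a hs).trans ?_)
  gcongr with x
  exact le_iSup (fun d => truncMax g d a s x) d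
end
end
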